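/- arXiv:2501.12939 — 2 statements merged into one kernel-verified Lean document; each statement's English description precedes it below -/
import Mathlib

section
/- Let p > 1, T > 0, a > 0 and b ≥ 0. The infimum λ_p^{a,b}(-T,T) is attained by some nonzero function u ∈ W^{1,p}_0(-T,T) (equivalently, λ_p^{a,b}(-T,T) is a fundamental frequency of the one-dimensional asymmetric p-Laplace operator u ↦ -(a^p[(u')^+]^{p-1} - b^p[(u')^-]^{p-1})') if and only if b > 0. -/
open MeasureTheory Filter Set
open scoped Topology RealInnerProductSpace

noncomputable section

/-- Positive part. -/
def ppart (t : ℝ) : ℝ := max t 0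
/-- Negative part. -/
def npart (t : ℝ) : ℝ := max (-t) 0

/-- `u ∈ W^{1,p}(α,β)` (continuous representative on `[α,β]`), with weak derivative `u'`. -/
def MemW1pC (p α β : ℝ) (u u' : ℝ → ℝ) : Prop :=
  IntervalIntegrable u' volume α β ∧
  (∀ t ∈ Set.Icc α β, u t = u α + ∫ s in α..t, u' s) ∧
  IntegrableOn (fun t => |u' t| ^ p) (Set.Ioo α β) volume

/-- `u ∈ W^{1,p}_0(α,β)`, with weak derivative `u'`. -/
def MemW1p0 (p α β : ℝ) (u u' : ℝ → ℝ) : Prop :=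
  MemW1pC p α β u u' ∧ u α = 0 ∧ u β = 0

/-- `u ∈ W^{1,p}(α,β)` (interior version: no constraint at endpoints). -/
def MemW1pI (p α β : ℝ) (u u' : ℝ → ℝ) : Prop :=
  IntervalIntegrable u' volume α β ∧
  (∀ s ∈ Set.Ioo α β, ∀ t ∈ Set.Ioo α β, u t = u s + ∫ r in s..t, u' r) ∧
  IntegrableOn (fun t => |u' t| ^ p) (Set.Ioo α β) volume

/-- `λ_p^H(α,β)` for a one-dimensional anisotropy `H`. -/
def lamH1 (p : ℝ) (H : ℝ → ℝ) (α β : ℝ) : ℝ :=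
  sInf { E | ∃ u u', MemW1p0 p α β u u' ∧ (∫ t in Set.Ioo α β, |u t| ^ p) = 1 ∧
    E = ∫ t in Set.Ioo α β, H (u' t) ^ p }

/-- `λ_{1,p}(α,β)`, the principal Dirichlet eigenvalue of the 1d `p`-Laplacian. -/
def lam1 (p α β : ℝ) : ℝ := lamH1 p (fun t => |t|) α β

/-- `λ_p^{a,b}(α,β)`. -/
def lamAB (p a b α β : ℝ) : ℝ := lamH1 p (fun t => a * ppart t + b * npart t) α β

/-- `λ_p^+(-T,T)`. -/
def lamPlus (p T : ℝ) : ℝ := lamH1 p ppart (-T) T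

/-- `φ` is the (normalized positive) principal eigenfunction of the 1d `p`-Laplacian
on `(-T,T)`, with weak derivative `φ'`. -/
def IsPrincipalEigenfunction (p T : ℝ) (φ φ' : ℝ → ℝ) : Prop :=
  MemW1p0 p (-T) T φ φ' ∧ (∀ t ∈ Set.Ioo (-T) T, 0 < φ t) ∧
  (∫ t in Set.Ioo (-T) T, |φ t| ^ p) = 1 ∧
  (∫ t in Set.Ioo (-T) T, |φ' t| ^ p) = lam1 p (-T) T

/-- The piecewise Sobolev class `W_pw^{1,p,+}(-T,T)`. -/
def MemWpw (p T : ℝ) (u u' : ℝ → ℝ) : Prop :=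
  ∃ (m : ℕ) (P : ℕ → ℝ), 0 < m ∧ P 0 = -T ∧ P m = T ∧
    (∀ i < m, P i < P (i + 1)) ∧
    (∀ i < m, MemW1pI p (P i) (P (i + 1)) u u') ∧
    (∃ l₀, Tendsto u (𝓝[>] (-T)) (𝓝 l₀) ∧ l₀ ≤ 0) ∧
    (∃ l₁, Tendsto u (𝓝[<] T) (𝓝 l₁) ∧ 0 ≤ l₁) ∧
    (∀ i, 0 < i → i < m → ∃ lm lp, Tendsto u (𝓝[<] (P i)) (𝓝 lm) ∧
      Tendsto u (𝓝[>] (P i)) (𝓝 lp) ∧ lp < lm)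

/-! ### Two dimensions -/

/-- The Euclidean plane. -/
abbrev V2 := EuclideanSpace ℝ (Fin 2)

/-- The point of `ℝ²` with coordinates `(x, y)`. -/
def mk2 (x y : ℝ) : V2 := (EuclideanSpace.equiv (Fin 2) ℝ).symm ![x, y]

/-- An asymmetric anisotropy: nonnegative, convex and positively 1-homogeneous. -/
def IsAnisotropy (H : V2 → ℝ) : Prop :=
  (∀ v, 0 ≤ H v) ∧ ConvexOn ℝ Set.univ H ∧ ∀ t : ℝ, 0 < t → ∀ v : V2, H (t • v) = t * H v

/-- A bounded domain of `ℝ²`. -/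
def IsBoundedDomain (Ω : Set V2) : Prop :=
  IsOpen Ω ∧ IsConnected Ω ∧ Bornology.IsBounded Ω

/-- Smooth compactly supported test function on `Ω`. -/
def TestFun2 (Ω : Set V2) (φ : V2 → ℝ) : Prop :=
  ContDiff ℝ (⊤ : ℕ∞) φ ∧ HasCompactSupport φ ∧ tsupport φ ⊆ Ω

/-- `u ∈ W^{1,p}_0(Ω)`, with weak gradient `g`: `u` and `g` are `p`-integrable on `Ω`
and approximable in `W^{1,p}`-norm by smooth functions compactly supported in `Ω`. -/
def MemW1p02 (p : ℝ) (Ω : Set V2) (u : V2 → ℝ) (g : V2 → V2) : Prop :=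
  IntegrableOn (fun x => |u x| ^ p) Ω volume ∧
  IntegrableOn (fun x => ‖g x‖ ^ p) Ω volume ∧
  ∃ φ : ℕ → V2 → ℝ, (∀ n, TestFun2 Ω (φ n)) ∧
    Tendsto (fun n => ∫ x in Ω, |u x - φ n x| ^ p) atTop (𝓝 0) ∧
    Tendsto (fun n => ∫ x in Ω, ‖g x - gradient (φ n) x‖ ^ p) atTop (𝓝 0)

/-- The least anisotropic energy level `λ_p^H(Ω)`. -/
def lamH (p : ℝ) (H : V2 → ℝ) (Ω : Set V2) : ℝ :=
  sInf { E | ∃ u g, MemW1p02 p Ω u g ∧ (∫ x in Ω, |u x| ^ p) = 1 ∧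
    E = ∫ x in Ω, H (g x) ^ p }

/-- `λ_p^H(Ω)` is a fundamental frequency of `-Δ_p^H` on `Ω`. -/
def IsFundFreq (p : ℝ) (H : V2 → ℝ) (Ω : Set V2) : Prop :=
  ∃ u g, MemW1p02 p Ω u g ∧ ¬ (∀ᵐ x ∂(volume.restrict Ω), u x = 0) ∧
    (∀ᵐ x ∂(volume.restrict Ω), DifferentiableAt ℝ H (g x)) ∧
    AEMeasurable (fun x => gradient H (g x)) (volume.restrict Ω) ∧
    ∀ φ gφ, MemW1p02 p Ω φ gφ →
      (∫ x in Ω, H (g x) ^ (p - 1) * ⟪gradient H (g x), gφ x⟫) =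
        lamH p H Ω * ∫ x in Ω, |u x| ^ (p - 2) * u x * φ x

/-- The infimum `λ_p^H(Ω)` is attained by a (normalized, hence nonzero) function. -/
def IsAttained (p : ℝ) (H : V2 → ℝ) (Ω : Set V2) : Prop :=
  ∃ u g, MemW1p02 p Ω u g ∧ (∫ x in Ω, |u x| ^ p) = 1 ∧
    (∫ x in Ω, H (g x) ^ p) = lamH p H Ω

/-- `‖H‖ := max {H v : |v| = 1}`. -/
def normH (H : V2 → ℝ) : ℝ := sSup (H '' Metric.sphere 0 1)

/-- A rotation: a linear isometry with positive determinant. -/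
def IsRotation (A : V2 ≃ₗᵢ[ℝ] V2) : Prop :=
  0 < LinearMap.det (A.toLinearEquiv : V2 →ₗ[ℝ] V2)

/-- The kernel of an anisotropy. -/
def kerH (H : V2 → ℝ) : Set V2 := {v | H v = 0}

/-- `S` is a line through the origin. -/
def IsLine (S : Set V2) : Prop := ∃ v : V2, v ≠ 0 ∧ S = {w | ∃ t : ℝ, w = t • v}

/-- `S` is a closed half-plane bounded by a line through the origin. -/
def IsClosedHalfPlane (S : Set V2) : Prop := ∃ v : V2, v ≠ 0 ∧ S = {w | ⟪v, w⟫ ≤ 0}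

/-- Smooth compactly supported test function on an open set `S ⊆ ℝ`. -/
def TestFun1 (S : Set ℝ) (φ : ℝ → ℝ) : Prop :=
  ContDiff ℝ (⊤ : ℕ∞) φ ∧ HasCompactSupport φ ∧ tsupport φ ⊆ S

/-- `v ∈ W^{1,p}_0(S)` for an open set `S ⊆ ℝ`, with weak derivative `v'`. -/
def MemW1p0S (p : ℝ) (S : Set ℝ) (v v' : ℝ → ℝ) : Prop :=
  IntegrableOn (fun t => |v t| ^ p) S volume ∧
  IntegrableOn (fun t => |v' t| ^ p) S volume ∧
  ∃ φ : ℕ → ℝ → ℝ, (∀ n, TestFun1 S (φ n)) ∧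
    Tendsto (fun n => ∫ t in S, |v t - φ n t| ^ p) atTop (𝓝 0) ∧
    Tendsto (fun n => ∫ t in S, |v' t - deriv (φ n) t| ^ p) atTop (𝓝 0)

/-- A bounded domain with Lipschitz (`C^{0,1}`) boundary: near each boundary point, after a
rigid motion, `Ω` is the region above the graph of a Lipschitz function. -/
def IsC01Domain (Ω : Set V2) : Prop :=
  IsBoundedDomain Ω ∧
  ∀ z ∈ frontier Ω, ∃ (A : V2 ≃ₗᵢ[ℝ] V2) (r K : ℝ) (f : ℝ → ℝ), 0 < r ∧ 0 ≤ K ∧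
    LipschitzWith (Real.toNNReal K) f ∧
    ∀ v ∈ Metric.ball z r, (v ∈ Ω ↔ f ((A (v - z)) 0) < (A (v - z)) 1)

/-- The supremal length of a vertical open segment contained in `D`. -/
def vertWidth (D : Set V2) : ℝ :=
  sSup {l : ℝ | ∃ x c : ℝ, ∀ y ∈ Set.Ioo c (c + l), mk2 x y ∈ D}

/-- The width function `L_θ` of `Ω` in direction `θ`. -/
def widthFn (Ω : Set V2) (θ : ℝ) : ℝ :=
  sSup {l : ℝ | ∃ (v : V2) (t0 : ℝ),
    ∀ t ∈ Set.Ioo t0 (t0 + l), v + t • mk2 (Real.cos θ) (Real.sin θ) ∈ Ω}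

/-- The variational `p`-capacity of `K` relative to `B`. -/
def pCap (p : ℝ) (K B : Set V2) : ℝ :=
  sInf { E | ∃ φ : V2 → ℝ, ContDiff ℝ (⊤ : ℕ∞) φ ∧ HasCompactSupport φ ∧ tsupport φ ⊆ B ∧
    (∀ x ∈ K, 1 ≤ φ x) ∧ E = ∫ x, ‖gradient φ x‖ ^ p }

/-- The Wiener criterion for the `p`-Laplacian at a boundary point `z`:
the Wiener integral diverges. -/
def WienerRegularAt (p : ℝ) (Ω : Set V2) (z : V2) : Prop :=
  ¬ IntegrableOn (fun t =>
      (pCap p (Metric.closedBall z t \ Ω) (Metric.ball z (2 * t)) /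
        pCap p (Metric.closedBall z t) (Metric.ball z (2 * t))) ^ (1 / (p - 1)) / t)
    (Set.Ioo (0 : ℝ) 1) volume

/-- The optimal lower spectral constant `Λ^min(Ω)`. -/
def LambdaMin (p : ℝ) (Ω : Set V2) : ℝ :=
  sInf {lam : ℝ | ∃ H : V2 → ℝ, IsAnisotropy H ∧ normH H = 1 ∧ IsFundFreq p H Ω ∧
    lam = lamH p H Ω}

end

noncomputable section

/-! ### The one-dimensional integrand -/

/-- The integrand `(a t⁺ + b t⁻) ^ p`. -/
def asymPow (p a b x : ℝ) : ℝ := (a * ppart x + b * npart x) ^ p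

lemma ppart_nonneg (x : ℝ) : 0 ≤ ppart x := le_max_right _ _

lemma npart_nonneg (x : ℝ) : 0 ≤ npart x := le_max_right _ _

lemma ppart_of_nonneg {x : ℝ} (hx : 0 ≤ x) : ppart x = x := max_eq_left hx

lemma ppart_of_nonpos {x : ℝ} (hx : x ≤ 0) : ppart x = 0 := max_eq_right hx

lemma npart_of_nonneg {x : ℝ} (hx : 0 ≤ x) : npart x = 0 := max_eq_right (by linarith)

lemma npart_of_nonpos {x : ℝ} (hx : x ≤ 0) : npart x = -x := max_eq_left (by linarith)

lemma npart_eq_ppart_neg (x : ℝ) : npart x = ppart (-x) := rfl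

lemma ppart_le_abs (x : ℝ) : ppart x ≤ |x| := max_le (le_abs_self x) (abs_nonneg x)

lemma npart_le_abs (x : ℝ) : npart x ≤ |x| := max_le (neg_le_abs x) (abs_nonneg x)

lemma ppart_add_npart (x : ℝ) : ppart x + npart x = |x| := by
  rcases le_total 0 x with h | h
  · simp [ppart_of_nonneg, npart_of_nonneg, h, abs_of_nonneg]
  · simp [ppart_of_nonpos, npart_of_nonpos, h, abs_of_nonpos]

lemma continuous_ppart : Continuous ppart := by unfold ppart; fun_prop

lemma continuous_npart : Continuous npart := by unfold npart; fun_prop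

lemma ppart_mul {c : ℝ} (hc : 0 ≤ c) (x : ℝ) : ppart (c * x) = c * ppart x := by
  rw [ppart, ppart, mul_max_of_nonneg _ _ hc, mul_zero]

lemma npart_mul {c : ℝ} (hc : 0 ≤ c) (x : ℝ) : npart (c * x) = c * npart x := by
  rw [npart, npart, mul_max_of_nonneg _ _ hc, mul_zero, mul_neg]

lemma ppart_add_le (x y : ℝ) : ppart (x + y) ≤ ppart x + ppart y :=
  max_le (add_le_add (le_max_left _ _) (le_max_left _ _))
    (add_nonneg (ppart_nonneg x) (ppart_nonneg y))

section AsymPow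

variable {p a b : ℝ}

lemma asym_nonneg (ha : 0 ≤ a) (hb : 0 ≤ b) (x : ℝ) : 0 ≤ a * ppart x + b * npart x :=
  add_nonneg (mul_nonneg ha (ppart_nonneg x)) (mul_nonneg hb (npart_nonneg x))

lemma asymPow_nonneg (ha : 0 ≤ a) (hb : 0 ≤ b) (x : ℝ) : 0 ≤ asymPow p a b x :=
  Real.rpow_nonneg (asym_nonneg ha hb x) p

lemma continuous_asymPow (hp : 0 ≤ p) : Continuous (asymPow p a b) :=
  ((continuous_const.mul continuous_ppart).add
    (continuous_const.mul continuous_npart)).rpow_const fun _ => Or.inr hp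

lemma asymPow_mul (ha : 0 ≤ a) (hb : 0 ≤ b) {c : ℝ} (hc : 0 ≤ c) (x : ℝ) :
    asymPow p a b (c * x) = c ^ p * asymPow p a b x := by
  rw [asymPow, asymPow, ppart_mul hc, npart_mul hc, ← Real.mul_rpow hc (asym_nonneg ha hb x)]
  ring_nf

lemma asymPow_eq (hp : 0 < p) (ha : 0 ≤ a) (hb : 0 ≤ b) (x : ℝ) :
    asymPow p a b x = a ^ p * ppart x ^ p + b ^ p * npart x ^ p := by
  rcases le_total 0 x with h | h
  · simp [asymPow, ppart_of_nonneg h, npart_of_nonneg h, Real.zero_rpow hp.ne', Real.mul_rpow ha h]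
  · simp [asymPow, ppart_of_nonpos h, npart_of_nonpos h, Real.zero_rpow hp.ne',
      ← Real.mul_rpow hb (neg_nonneg.2 h)]

lemma asymPow_le (hp : 0 < p) (ha : 0 ≤ a) (hb : 0 ≤ b) (x : ℝ) :
    asymPow p a b x ≤ (a ^ p + b ^ p) * |x| ^ p := by
  rw [asymPow_eq hp ha hb, add_mul]
  have h1 := Real.rpow_le_rpow (ppart_nonneg x) (ppart_le_abs x) hp.le
  have h2 := Real.rpow_le_rpow (npart_nonneg x) (npart_le_abs x) hp.le
  have := Real.rpow_nonneg ha p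
  have := Real.rpow_nonneg hb p
  gcongr

lemma le_asymPow (hp : 0 ≤ p) {m : ℝ} (hm : 0 ≤ m) (hma : m ≤ a) (hmb : m ≤ b) (x : ℝ) :
    m ^ p * |x| ^ p ≤ asymPow p a b x := by
  rw [← Real.mul_rpow hm (abs_nonneg x), ← ppart_add_npart, mul_add]
  have := ppart_nonneg x
  have := npart_nonneg x
  exact Real.rpow_le_rpow (by positivity) (by gcongr) hp

lemma convexOn_asymPow (hp : 1 ≤ p) (ha : 0 ≤ a) (hb : 0 ≤ b) :
    ConvexOn ℝ univ (asymPow p a b) := by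
  have hsub : (fun x => a * ppart x + b * npart x) '' univ ⊆ Ici 0 := by
    rintro _ ⟨x, -, rfl⟩
    exact asym_nonneg ha hb x
  have hH : ConvexOn ℝ univ fun x => a * ppart x + b * npart x := by
    refine ⟨convex_univ, fun x _ y _ s t hs ht _ => ?_⟩
    simp only [smul_eq_mul]
    have h1 := ppart_add_le (s * x) (t * y)
    have h2 := ppart_add_le (-(s * x)) (-(t * y))
    rw [← neg_add, ← npart_eq_ppart_neg, ← npart_eq_ppart_neg, ← npart_eq_ppart_neg,
      npart_mul hs, npart_mul ht] at h2
    rw [ppart_mul hs, ppart_mul ht] at h1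
    nlinarith [mul_le_mul_of_nonneg_left h1 ha, mul_le_mul_of_nonneg_left h2 hb]
  have himg : Convex ℝ ((fun x => a * ppart x + b * npart x) '' univ) := by
    have hc : Continuous fun x => a * ppart x + b * npart x :=
      (continuous_const.mul continuous_ppart).add (continuous_const.mul continuous_npart)
    exact (isPreconnected_univ.image _ hc.continuousOn).ordConnected.convex
  exact ((convexOn_rpow hp).subset hsub himg).comp hH
    fun x hx y hy hxy => Real.rpow_le_rpow (hsub hx) hxy (by linarith)

lemma hasDerivAt_ppart_rpow (hp : 1 < p) (x : ℝ) :
    HasDerivAt (fun x => ppart x ^ p) (p * ppart x ^ (p - 1)) x := by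
  have h0 : (0 : ℝ) ^ p = 0 := Real.zero_rpow (by linarith)
  have h1 : (0 : ℝ) ^ (p - 1) = 0 := Real.zero_rpow (by linarith)
  have hd := Real.hasDerivAt_rpow_const (x := x) (p := p) (Or.inr hp.le)
  rcases lt_trichotomy x 0 with hx | rfl | hx
  · rw [ppart_of_nonpos hx.le, h1, mul_zero]
    refine (hasDerivAt_const x (0 : ℝ)).congr_of_eventuallyEq ?_
    filter_upwards [Iio_mem_nhds hx] with y hy
    rw [ppart_of_nonpos (le_of_lt hy), h0]
  · rw [ppart_of_nonpos le_rfl]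
    rw [← hasDerivWithinAt_univ, ← Iic_union_Ici (a := (0 : ℝ))]
    refine HasDerivWithinAt.union ?_ ?_
    · rw [h1, mul_zero]
      refine (hasDerivWithinAt_const (0 : ℝ) (Iic 0) (0 : ℝ)).congr (fun y hy => ?_) ?_
      · rw [ppart_of_nonpos hy, h0]
      · rw [ppart_of_nonpos le_rfl, h0]
    · refine hd.hasDerivWithinAt.congr (fun y hy => ?_) ?_
      · rw [ppart_of_nonneg hy]
      · rw [ppart_of_nonneg le_rfl]
  · rw [ppart_of_nonneg hx.le]
    refine hd.congr_of_eventuallyEq ?_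
    filter_upwards [Ioi_mem_nhds hx] with y hy
    rw [ppart_of_nonneg (le_of_lt hy)]

lemma hasDerivAt_asymPow (hp : 1 < p) (ha : 0 ≤ a) (hb : 0 ≤ b) (x : ℝ) :
    HasDerivAt (asymPow p a b)
      (p * (a ^ p * ppart x ^ (p - 1) - b ^ p * npart x ^ (p - 1))) x := by
  have h1 := (hasDerivAt_ppart_rpow hp x).const_mul (a ^ p)
  have h2 := (((hasDerivAt_ppart_rpow hp (-x)).comp x (hasDerivAt_neg x))).const_mul (b ^ p)
  have h := h1.add h2
  have heq : asymPow p a b = _ := funext fun y => asymPow_eq (by linarith) ha hb y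
  rw [heq]
  convert! h using 1
  rw [npart_eq_ppart_neg]
  ring

lemma abs_deriv_asymPow_le (hp : 1 < p) (ha : 0 ≤ a) (hb : 0 ≤ b) (x : ℝ) :
    |p * (a ^ p * ppart x ^ (p - 1) - b ^ p * npart x ^ (p - 1))|
      ≤ p * (a ^ p + b ^ p) * |x| ^ (p - 1) := by
  have h1 := Real.rpow_le_rpow (ppart_nonneg x) (ppart_le_abs x) (by linarith : 0 ≤ p - 1)
  have h2 := Real.rpow_le_rpow (npart_nonneg x) (npart_le_abs x) (by linarith : 0 ≤ p - 1)
  have h3 := Real.rpow_nonneg ha p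
  have h4 := Real.rpow_nonneg hb p
  have h5 := Real.rpow_nonneg (ppart_nonneg x) (p - 1)
  have h6 := Real.rpow_nonneg (npart_nonneg x) (p - 1)
  rw [abs_mul, abs_of_pos (by linarith : 0 < p), mul_assoc]
  refine mul_le_mul_of_nonneg_left ?_ (by linarith)
  rw [abs_le]
  constructor <;> nlinarith [mul_le_mul_of_nonneg_left h1 h3, mul_le_mul_of_nonneg_left h2 h4,
    mul_nonneg h3 h5, mul_nonneg h4 h6]

lemma abs_deriv_abs_rpow (hp : 1 < p) (x : ℝ) :
    |p * |x| ^ (p - 2) * x| = p * |x| ^ (p - 1) := by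
  rcases eq_or_ne x 0 with rfl | hx
  · simp [Real.zero_rpow (by linarith : p - 1 ≠ 0)]
  · rw [abs_mul, abs_mul, abs_of_pos (by linarith : 0 < p),
      abs_of_nonneg (Real.rpow_nonneg (abs_nonneg x) _), mul_assoc,
      ← Real.rpow_add_one (abs_ne_zero.2 hx)]
    ring_nf

end AsymPow

/-! ### First variation of power-type functionals -/

lemma rpow_add_le_two_rpow {p x y : ℝ} (hp : 0 ≤ p) (hx : 0 ≤ x) (hy : 0 ≤ y) :
    (x + y) ^ p ≤ 2 ^ p * (x ^ p + y ^ p) := by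
  have h1 := Real.rpow_nonneg hx p
  have h2 := Real.rpow_nonneg hy p
  have h3 : (0 : ℝ) ≤ 2 ^ p := by positivity
  rcases le_total x y with h | h
  · calc (x + y) ^ p ≤ (2 * y) ^ p := Real.rpow_le_rpow (by positivity) (by linarith) hp
      _ = 2 ^ p * y ^ p := Real.mul_rpow (by norm_num) hy
      _ ≤ _ := by gcongr; linarith
  · calc (x + y) ^ p ≤ (2 * x) ^ p := Real.rpow_le_rpow (by positivity) (by linarith) hp
      _ = 2 ^ p * x ^ p := Real.mul_rpow (by norm_num) hx
      _ ≤ _ := by gcongr; linarith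

section FirstVariation

variable {α : Type*} [MeasurableSpace α] {μ : Measure α} {p : ℝ} {v φ : α → ℝ}

lemma aestronglyMeasurable_abs_rpow (hp : 0 ≤ p) (hv : AEStronglyMeasurable v μ) :
    AEStronglyMeasurable (fun t => |v t| ^ p) μ :=
  (continuous_abs.rpow_const fun _ => Or.inr hp).comp_aestronglyMeasurable hv

lemma integrable_abs_add_abs_rpow (hp : 0 ≤ p)
    (hv : AEStronglyMeasurable v μ) (hφ : AEStronglyMeasurable φ μ)
    (hvp : Integrable (fun t => |v t| ^ p) μ) (hφp : Integrable (fun t => |φ t| ^ p) μ) :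
    Integrable (fun t => (|v t| + |φ t|) ^ p) μ := by
  refine ((hvp.add hφp).const_mul (2 ^ p)).mono' ?_ (ae_of_all _ fun t => ?_)
  · exact (continuous_id.rpow_const fun _ => Or.inr hp).comp_aestronglyMeasurable
      (hv.norm.add hφ.norm)
  · rw [Real.norm_of_nonneg (by positivity)]
    exact rpow_add_le_two_rpow hp (abs_nonneg _) (abs_nonneg _)

lemma hasDerivAt_integral_comp_add_mul {C : ℝ} (hp : 1 < p) {f g : ℝ → ℝ}
    (hf : ∀ x, HasDerivAt f (g x) x) (hfC : ∀ x, |f x| ≤ C * |x| ^ p)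
    (hgC : ∀ x, |g x| ≤ C * |x| ^ (p - 1))
    (hv : AEStronglyMeasurable v μ) (hφ : AEStronglyMeasurable φ μ)
    (hvp : Integrable (fun t => |v t| ^ p) μ) (hφp : Integrable (fun t => |φ t| ^ p) μ) :
    Integrable (fun t => g (v t) * φ t) μ ∧
      HasDerivAt (fun s => ∫ t, f (v t + s * φ t) ∂μ) (∫ t, g (v t) * φ t ∂μ) 0 := by
  have hC : 0 ≤ C := by simpa using (abs_nonneg _).trans (hgC 1)
  have hfc : Continuous f := continuous_iff_continuousAt.2 fun x => (hf x).continuousAt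
  have hg : Measurable g := by
    rw [← funext fun x => (hf x).deriv]
    exact measurable_deriv f
  have hm : ∀ s : ℝ, AEStronglyMeasurable (fun t => v t + s * φ t) μ := fun s =>
    hv.add (hφ.const_mul s)
  have key := hasDerivAt_integral_of_dominated_loc_of_deriv_le (𝕜 := ℝ) (μ := μ)
    (F := fun s t => f (v t + s * φ t)) (F' := fun s t => g (v t + s * φ t) * φ t) (x₀ := 0)
    (s := Metric.ball 0 1) (bound := fun t => C * (|v t| + |φ t|) ^ p)
    (Metric.ball_mem_nhds 0 one_pos)
    (Eventually.of_forall fun s => hfc.comp_aestronglyMeasurable (hm s)) ?_ ?_ ?_ ?_ ?_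
  · simpa using key
  · simp only [zero_mul, add_zero]
    exact (hvp.const_mul C).mono' (hfc.comp_aestronglyMeasurable hv) (ae_of_all _ fun t => hfC _)
  · exact (hg.comp_aemeasurable (hm 0).aemeasurable).aestronglyMeasurable.mul hφ
  · refine ae_of_all _ fun t s hs => ?_
    have hs1 : |s| ≤ 1 := by
      have := Metric.mem_ball.1 hs
      rw [dist_zero_right, Real.norm_eq_abs] at this
      exact this.le
    have h1 : |v t + s * φ t| ≤ |v t| + |φ t| := by
      refine (abs_add_le _ _).trans (add_le_add le_rfl ?_)
      rw [abs_mul]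
      exact mul_le_of_le_one_left (abs_nonneg _) hs1
    have h2 : (0 : ℝ) ≤ |v t| + |φ t| := by positivity
    rw [norm_mul, Real.norm_eq_abs, Real.norm_eq_abs]
    calc |g (v t + s * φ t)| * |φ t|
        ≤ (C * (|v t| + |φ t|) ^ (p - 1)) * (|v t| + |φ t|) := by
          refine mul_le_mul ((hgC _).trans ?_) (by linarith [abs_nonneg (v t)])
            (abs_nonneg _) (by positivity)
          exact mul_le_mul_of_nonneg_left
            (Real.rpow_le_rpow (abs_nonneg _) h1 (by linarith)) hC
      _ = C * (|v t| + |φ t|) ^ p := by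
          rw [mul_assoc]
          congr 1
          rcases eq_or_ne (|v t| + |φ t|) 0 with h | h
          · rw [h, mul_zero, Real.zero_rpow (by linarith)]
          · rw [← Real.rpow_add_one h]
            ring_nf
  · exact (integrable_abs_add_abs_rpow (by linarith) hv hφ hvp hφp).const_mul C
  · refine ae_of_all _ fun t s _ => ?_
    have h1 : HasDerivAt (fun s : ℝ => v t + s * φ t) (φ t) s := by
      simpa using ((hasDerivAt_id s).mul_const (φ t)).const_add (v t)
    exact (hf _).comp s h1

end FirstVariation

/-! ### The spaces `W^{1,p}_0` and the Rayleigh quotient -/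

section Sobolev

variable {p a b α β : ℝ} {u u' φ φ' : ℝ → ℝ}

lemma MemW1pC.aestronglyMeasurable_deriv (h : MemW1pC p α β u u') (hαβ : α ≤ β) :
    AEStronglyMeasurable u' (volume.restrict (Ioo α β)) :=
  ((intervalIntegrable_iff_integrableOn_Ioo_of_le hαβ).1 h.1).aestronglyMeasurable

lemma MemW1pC.continuousOn (h : MemW1pC p α β u u') (hαβ : α ≤ β) : ContinuousOn u (Icc α β) := by
  have h1 := intervalIntegral.continuousOn_primitive_interval' h.1 left_mem_uIcc
  rw [uIcc_of_le hαβ] at h1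
  exact (continuousOn_const.add h1).congr h.2.1

lemma MemW1pC.aestronglyMeasurable (h : MemW1pC p α β u u') (hαβ : α ≤ β) :
    AEStronglyMeasurable u (volume.restrict (Ioo α β)) :=
  ((h.continuousOn hαβ).mono Ioo_subset_Icc_self).aestronglyMeasurable measurableSet_Ioo

lemma integrableOn_abs_rpow_of_continuousOn (hp : 0 ≤ p) (h : ContinuousOn u (Icc α β)) :
    IntegrableOn (fun t => |u t| ^ p) (Ioo α β) volume :=
  (((continuous_abs.rpow_const fun _ => Or.inr hp).comp_continuousOn h).integrableOn_Icc).mono_set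
    Ioo_subset_Icc_self

lemma MemW1pC.sub_eq (h : MemW1pC p α β u u') {s t : ℝ} (hs : s ∈ Icc α β) (ht : t ∈ Icc α β) :
    u t - u s = ∫ r in s..t, u' r := by
  have hαβ : α ≤ β := hs.1.trans hs.2
  have hint : ∀ r ∈ Icc α β, IntervalIntegrable u' volume α r := fun r hr =>
    h.1.mono_set (by rw [uIcc_of_le hαβ, uIcc_of_le hr.1]; exact Icc_subset_Icc_right hr.2)
  rw [h.2.1 s hs, h.2.1 t ht, ← intervalIntegral.integral_interval_sub_left (hint t ht) (hint s hs)]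
  ring

lemma integrable_asymPow (hp : 0 < p) (ha : 0 ≤ a) (hb : 0 ≤ b) {X : Type*} [MeasurableSpace X]
    {μ : Measure X} {v : X → ℝ} (hv : AEStronglyMeasurable v μ)
    (hvp : Integrable (fun t => |v t| ^ p) μ) : Integrable (fun t => asymPow p a b (v t)) μ := by
  refine (hvp.const_mul (a ^ p + b ^ p)).mono'
    ((continuous_asymPow hp.le).comp_aestronglyMeasurable hv) (ae_of_all _ fun t => ?_)
  rw [Real.norm_of_nonneg (asymPow_nonneg ha hb _)]
  exact asymPow_le hp ha hb _

lemma MemW1pC.integrable_asymPow (h : MemW1pC p α β u u') (hαβ : α ≤ β) (hp : 0 < p) (ha : 0 ≤ a)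
    (hb : 0 ≤ b) : IntegrableOn (fun t => asymPow p a b (u' t)) (Ioo α β) volume :=
  _root_.integrable_asymPow hp ha hb (h.aestronglyMeasurable_deriv hαβ) h.2.2

lemma MemW1p0.const_mul (h : MemW1p0 p α β u u') (c : ℝ) :
    MemW1p0 p α β (fun t => c * u t) (fun t => c * u' t) := by
  refine ⟨⟨h.1.1.const_mul c, fun t ht => ?_, ?_⟩, ?_, ?_⟩
  · beta_reduce
    rw [intervalIntegral.integral_const_mul, h.1.2.1 t ht]
    ring
  · simp_rw [abs_mul, Real.mul_rpow (abs_nonneg c) (abs_nonneg _)]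
    exact h.1.2.2.const_mul _
  · simp [h.2.1]
  · simp [h.2.2]

lemma MemW1p0.add (hu : MemW1p0 p α β u u') (hφ : MemW1p0 p α β φ φ') (hαβ : α ≤ β)
    (hp : 0 ≤ p) : MemW1p0 p α β (fun t => u t + φ t) (fun t => u' t + φ' t) := by
  refine ⟨⟨hu.1.1.add hφ.1.1, fun t ht => ?_, ?_⟩, ?_, ?_⟩
  · have hsub : uIcc α t ⊆ uIcc α β := by
      rw [uIcc_of_le hαβ, uIcc_of_le ht.1]
      exact Icc_subset_Icc_right ht.2
    beta_reduce
    rw [intervalIntegral.integral_add (hu.1.1.mono_set hsub) (hφ.1.1.mono_set hsub),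
      hu.1.2.1 t ht, hφ.1.2.1 t ht]
    ring
  · have hu1 := hu.1.aestronglyMeasurable_deriv hαβ
    have hφ1 := hφ.1.aestronglyMeasurable_deriv hαβ
    refine (integrable_abs_add_abs_rpow hp hu1 hφ1 hu.1.2.2 hφ.1.2.2).mono'
      (aestronglyMeasurable_abs_rpow hp (hu1.add hφ1)) (ae_of_all _ fun t => ?_)
    rw [Real.norm_of_nonneg (by positivity)]
    exact Real.rpow_le_rpow (abs_nonneg _) (abs_add_le _ _) hp
  · simp [hu.2.1, hφ.2.1]
  · simp [hu.2.2, hφ.2.2]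

lemma lamAB_nonneg (ha : 0 ≤ a) (hb : 0 ≤ b) : 0 ≤ lamAB p a b α β := by
  refine Real.sInf_nonneg ?_
  rintro _ ⟨u, u', -, -, rfl⟩
  exact integral_nonneg fun t => asymPow_nonneg ha hb _

lemma lamAB_le (ha : 0 ≤ a) (hb : 0 ≤ b) (hu : MemW1p0 p α β u u')
    (hN : ∫ t in Ioo α β, |u t| ^ p = 1) :
    lamAB p a b α β ≤ ∫ t in Ioo α β, asymPow p a b (u' t) := by
  refine csInf_le ⟨0, ?_⟩ ⟨u, u', hu, hN, rfl⟩
  rintro _ ⟨u, u', -, -, rfl⟩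
  exact integral_nonneg fun t => asymPow_nonneg ha hb _

lemma MemW1p0.normalize (hp : 0 < p) (hu : MemW1p0 p α β u u')
    (hN : 0 < ∫ t in Ioo α β, |u t| ^ p) :
    ∃ c, 0 < c ∧ c ^ p * ∫ t in Ioo α β, |u t| ^ p = 1 ∧
      MemW1p0 p α β (fun t => c * u t) (fun t => c * u' t) ∧
      ∫ t in Ioo α β, |c * u t| ^ p = 1 := by
  set N := ∫ t in Ioo α β, |u t| ^ p with hNdef
  have hc : 0 < N ^ (-p⁻¹) := Real.rpow_pos_of_pos hN _
  have hcN : (N ^ (-p⁻¹)) ^ p * N = 1 := by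
    rw [← Real.rpow_mul hN.le, neg_mul, inv_mul_cancel₀ hp.ne', Real.rpow_neg_one,
      inv_mul_cancel₀ hN.ne']
  refine ⟨N ^ (-p⁻¹), hc, hcN, hu.const_mul _, ?_⟩
  simp_rw [abs_mul, Real.mul_rpow (abs_nonneg _) (abs_nonneg _), abs_of_pos hc]
  rw [integral_const_mul, hcN]

lemma lamAB_mul_le (hp : 0 < p) (ha : 0 ≤ a) (hb : 0 ≤ b) (hu : MemW1p0 p α β u u') :
    lamAB p a b α β * ∫ t in Ioo α β, |u t| ^ p ≤ ∫ t in Ioo α β, asymPow p a b (u' t) := by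
  rcases (integral_nonneg fun t => Real.rpow_nonneg (abs_nonneg (u t)) p :
    0 ≤ ∫ t in Ioo α β, |u t| ^ p).eq_or_lt with h0 | hN
  · rw [← h0, mul_zero]
    exact integral_nonneg fun t => asymPow_nonneg ha hb _
  · obtain ⟨c, hc, hcN, hcu, hcu1⟩ := hu.normalize hp hN
    have h := lamAB_le ha hb hcu hcu1
    simp_rw [asymPow_mul ha hb hc.le, integral_const_mul] at h
    have hcp : 0 < c ^ p := Real.rpow_pos_of_pos hc p
    refine le_of_mul_le_mul_left ?_ hcp
    calc c ^ p * (lamAB p a b α β * ∫ t in Ioo α β, |u t| ^ p)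
        = lamAB p a b α β * (c ^ p * ∫ t in Ioo α β, |u t| ^ p) := by ring
      _ ≤ _ := by rwa [hcN, mul_one]

/-- A normalized minimizer solves the Euler–Lagrange equation. -/
lemma euler_lagrange_of_attained (hp : 1 < p) (hαβ : α ≤ β) (ha : 0 ≤ a) (hb : 0 ≤ b)
    (hu : MemW1p0 p α β u u') (hN : ∫ t in Ioo α β, |u t| ^ p = 1)
    (hE : ∫ t in Ioo α β, asymPow p a b (u' t) = lamAB p a b α β)
    (hφ : MemW1p0 p α β φ φ') :
    ∫ t in Ioo α β, (a ^ p * ppart (u' t) ^ (p - 1) - b ^ p * npart (u' t) ^ (p - 1)) * φ' t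
      = lamAB p a b α β * ∫ t in Ioo α β, |u t| ^ (p - 2) * u t * φ t := by
  have hp0 : 0 < p := by linarith
  have hap := Real.rpow_nonneg ha p
  have hbp := Real.rpow_nonneg hb p
  obtain ⟨-, h1⟩ := hasDerivAt_integral_comp_add_mul (μ := volume.restrict (Ioo α β))
    (C := p * (a ^ p + b ^ p)) hp (hasDerivAt_asymPow hp ha hb)
    (fun x => by
      rw [abs_of_nonneg (asymPow_nonneg ha hb x)]
      refine (asymPow_le hp0 ha hb x).trans
        (mul_le_mul_of_nonneg_right ?_ (Real.rpow_nonneg (abs_nonneg x) p))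
      nlinarith)
    (abs_deriv_asymPow_le hp ha hb) (hu.1.aestronglyMeasurable_deriv hαβ)
    (hφ.1.aestronglyMeasurable_deriv hαβ) hu.1.2.2 hφ.1.2.2
  obtain ⟨-, h2⟩ := hasDerivAt_integral_comp_add_mul (μ := volume.restrict (Ioo α β))
    (C := p) (f := fun x => |x| ^ p) hp (fun x => hasDerivAt_abs_rpow x hp)
    (fun x => by
      have := Real.rpow_nonneg (abs_nonneg x) p
      rw [abs_of_nonneg this]
      nlinarith)
    (fun x => (abs_deriv_abs_rpow hp x).le) (hu.1.aestronglyMeasurable hαβ)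
    (hφ.1.aestronglyMeasurable hαβ)
    (integrableOn_abs_rpow_of_continuousOn hp0.le (hu.1.continuousOn hαβ))
    (integrableOn_abs_rpow_of_continuousOn hp0.le (hφ.1.continuousOn hαβ))
  have hmin : IsLocalMin (fun s => (∫ t in Ioo α β, asymPow p a b (u' t + s * φ' t)) -
      lamAB p a b α β * ∫ t in Ioo α β, |u t + s * φ t| ^ p) 0 := by
    refine Eventually.of_forall fun s => ?_
    have h := lamAB_mul_le hp0 ha hb (hu.add (hφ.const_mul s) hαβ hp0.le)
    simp only [zero_mul, add_zero, hN, hE, mul_one, sub_self]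
    linarith
  have h0 := hmin.hasDerivAt_eq_zero (h1.sub (h2.const_mul (lamAB p a b α β)))
  have e1 : ∫ t in Ioo α β, p * (a ^ p * ppart (u' t) ^ (p - 1) - b ^ p * npart (u' t) ^ (p - 1))
      * φ' t = p * ∫ t in Ioo α β,
        (a ^ p * ppart (u' t) ^ (p - 1) - b ^ p * npart (u' t) ^ (p - 1)) * φ' t := by
    rw [← integral_const_mul]
    simp only [mul_assoc]
  have e2 : ∫ t in Ioo α β, p * |u t| ^ (p - 2) * u t * φ t
      = p * ∫ t in Ioo α β, |u t| ^ (p - 2) * u t * φ t := by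
    rw [← integral_const_mul]
    simp only [mul_assoc]
  rw [e1, e2] at h0
  refine mul_left_cancel₀ hp0.ne' ?_
  linarith

end Sobolev

/-! ### Nonexistence for the degenerate operator -/

section Degenerate

variable {p α β : ℝ} {u u' f g : ℝ → ℝ}

lemma MemW1pC.of_absolutelyContinuousOnInterval (hαβ : α ≤ β)
    (hf : AbsolutelyContinuousOnInterval f α β)
    (hd : ∀ᵐ t, t ∈ Icc α β → HasDerivAt f (g t) t)
    (hg : IntegrableOn (fun t => |g t| ^ p) (Ioo α β) volume) : MemW1pC p α β f g := by
  refine ⟨?_, fun t ht => ?_, hg⟩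
  · refine hf.intervalIntegrable_deriv.congr_ae ?_
    rw [uIoc_of_le hαβ]
    refine (ae_restrict_iff' measurableSet_Ioc).2 ?_
    filter_upwards [hd] with t h ht
    exact (h (Ioc_subset_Icc_self ht)).deriv
  · have hsub : uIcc α t ⊆ uIcc α β := by
      rw [uIcc_of_le hαβ, uIcc_of_le ht.1]
      exact Icc_subset_Icc_right ht.2
    have h1 := (hf.mono hsub).integral_deriv_eq_sub
    have h2 : ∫ s in α..t, g s = ∫ s in α..t, deriv f s := by
      refine intervalIntegral.integral_congr_ae ?_
      filter_upwards [hd] with s h hs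
      rw [uIoc_of_le ht.1] at hs
      exact (h ⟨hs.1.le, hs.2.trans ht.2⟩).deriv.symm
    rw [h2, h1]
    ring

lemma abs_rpow_sub_two_mul_self {x : ℝ} (hx : 0 < x) :
    |x| ^ (p - 2) * x = ppart x ^ (p - 1) := by
  rw [abs_of_pos hx, ppart_of_nonneg hx.le]
  nth_rw 2 [← Real.rpow_one x]
  rw [← Real.rpow_add hx]
  ring_nf

/-- A solution of the degenerate equation, with positive frequency, is nonpositive. -/
lemma nonpos_of_degenerate_euler_lagrange (hp : 1 < p) {c lam : ℝ} (hc : 0 ≤ c)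
    (hlam : 0 < lam) (hu : MemW1p0 p α β u u')
    (hEL : ∀ φ φ', MemW1p0 p α β φ φ' → ∫ t in Ioo α β, c * ppart (u' t) ^ (p - 1) * φ' t
      = lam * ∫ t in Ioo α β, |u t| ^ (p - 2) * u t * φ t) {t₀ : ℝ} (ht₀ : t₀ ∈ Icc α β) :
    u t₀ ≤ 0 := by
  by_contra! hpos
  have hαβ : α ≤ β := ht₀.1.trans ht₀.2
  have huc := hu.1.continuousOn hαβ
  -- the first zero of `u` to the right of `t₀`
  obtain ⟨d, hd, hud, hdmin⟩ : ∃ d ∈ Icc t₀ β, u d ≤ 0 ∧ ∀ t ∈ Ico t₀ d, 0 < u t := by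
    have hcl : IsClosed (Icc t₀ β ∩ u ⁻¹' Iic 0) :=
      (huc.mono (Icc_subset_Icc_left ht₀.1)).preimage_isClosed_of_isClosed isClosed_Icc
        isClosed_Iic
    have hcomp : IsCompact (Icc t₀ β ∩ u ⁻¹' Iic 0) :=
      isCompact_Icc.of_isClosed_subset hcl inter_subset_left
    have hmem := hcomp.sInf_mem ⟨β, right_mem_Icc.2 ht₀.2, hu.2.2.le⟩
    refine ⟨_, hmem.1, hmem.2, fun t ht => ?_⟩
    by_contra! h
    exact notMem_of_lt_csInf ht.2 hcomp.bddBelow ⟨⟨ht.1, ht.2.le.trans hmem.1.2⟩, h⟩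
  have hdI : d ∈ Icc α β := ⟨ht₀.1.trans hd.1, hd.2⟩
  obtain ⟨t₁, ht₁, hut₁⟩ : ∃ t ∈ Icc t₀ d, u t = u t₀ / 2 :=
    intermediate_value_Icc' hd.1 (huc.mono (Icc_subset_Icc ht₀.1 hd.2))
      ⟨by linarith, by linarith⟩
  have ht₁d : t₁ < d := lt_of_le_of_ne ht₁.2 fun h => by rw [h] at hut₁; linarith
  have ht₁I : t₁ ∈ Icc α β := ⟨ht₀.1.trans ht₁.1, ht₁.2.trans hd.2⟩
  set w : ℝ → ℝ := (Ioi t₀).indicator fun t => npart (u' t) with hw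
  have hw0 : ∀ t, 0 ≤ w t := fun t => indicator_nonneg (fun _ _ => npart_nonneg _) t
  have hwle : ∀ t, |w t| ≤ |u' t| := fun t => by
    rw [abs_of_nonneg (hw0 t)]
    exact indicator_le' (fun _ _ => npart_le_abs _) (fun _ _ => abs_nonneg _) t
  have hwi : IntervalIntegrable w volume α β := by
    refine hu.1.1.mono_fun ?_ (ae_of_all _ hwle)
    rw [uIoc_of_le hαβ]
    exact (continuous_npart.comp_aestronglyMeasurable
      hu.1.1.1.aestronglyMeasurable).indicator measurableSet_Ioi
  have hsub : ∀ {s t}, s ∈ Icc α β → t ∈ Icc α β → uIcc s t ⊆ uIcc α β := fun hs ht => by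
    rw [uIcc_of_le hαβ]
    exact uIcc_subset_Icc hs ht
  set ζ : ℝ → ℝ := fun t => ∫ s in α..t, w s with hζ
  have hζ0 : ∀ t, α ≤ t → 0 ≤ ζ t := fun t ht =>
    intervalIntegral.integral_nonneg ht fun s _ => hw0 s
  have hζleft : ∀ t ∈ Icc α t₀, ζ t = 0 := fun t ht => by
    refine intervalIntegral.integral_zero_ae (ae_of_all _ fun s hs => ?_)
    rw [uIoc_of_le ht.1] at hs
    exact indicator_of_notMem (fun h => absurd (hs.2.trans ht.2) (not_le.2 h)) _
  have hζt₁ : 0 < ζ t₁ := by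
    have h1 : ∫ s in t₀..t₁, -u' s ≤ ∫ s in t₀..t₁, w s :=
      intervalIntegral.integral_mono_on_of_le_Ioo ht₁.1 (hu.1.1.mono_set (hsub ht₀ ht₁I)).neg
        (hwi.mono_set (hsub ht₀ ht₁I)) fun s hs => by
          rw [hw, indicator_of_mem (show s ∈ Ioi t₀ from hs.1)]
          exact le_max_left _ _
    rw [intervalIntegral.integral_neg, ← hu.1.sub_eq ht₀ ht₁I] at h1
    have h2 := intervalIntegral.integral_add_adjacent_intervals
      (hwi.mono_set (hsub (left_mem_Icc.2 hαβ) ht₀)) (hwi.mono_set (hsub ht₀ ht₁I))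
    have h3 := hζ0 t₀ ht₀.1
    simp only [hζ] at h3 ⊢
    linarith
  have hζac : AbsolutelyContinuousOnInterval ζ α β :=
    hwi.absolutelyContinuousOnInterval_intervalIntegral left_mem_uIcc
  set η : ℝ → ℝ := fun t => ppart (d - t) with hη
  have hηlip : LipschitzWith 1 η := by
    refine LipschitzWith.of_dist_le_mul fun x y => ?_
    rw [NNReal.coe_one, one_mul, Real.dist_eq, Real.dist_eq]
    refine (abs_max_sub_max_le_abs _ _ _).trans_eq ?_
    rw [sub_sub_sub_cancel_left, abs_sub_comm]
  set φ' : ℝ → ℝ := fun t => w t * η t - ζ t * (Iio d).indicator 1 t with hφ'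
  have hφ : MemW1p0 p α β (fun t => ζ t * η t) φ' := by
    refine ⟨MemW1pC.of_absolutelyContinuousOnInterval hαβ
      (hζac.fun_mul hηlip.lipschitzOnWith.absolutelyContinuousOnInterval) ?_ ?_, ?_, ?_⟩
    · have hne : ∀ᵐ t : ℝ, t ≠ d := by simp [ae_iff]
      filter_upwards [hwi.ae_hasDerivAt_integral, hne] with t ht htd htI
      rw [uIcc_of_le hαβ] at ht
      have h1 : HasDerivAt ζ (w t) t := ht htI α (left_mem_Icc.2 hαβ)
      have h2 : HasDerivAt η (-(Iio d).indicator 1 t) t := by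
        rcases lt_or_gt_of_ne htd with h | h
        · rw [indicator_of_mem (show t ∈ Iio d from h), Pi.one_apply]
          refine ((hasDerivAt_id t).const_sub d).congr_of_eventuallyEq ?_
          filter_upwards [Iio_mem_nhds h] with s hs
          exact ppart_of_nonneg (sub_nonneg.2 (le_of_lt hs))
        · rw [indicator_of_notMem (show t ∉ Iio d from not_lt.2 h.le), neg_zero]
          refine (hasDerivAt_const t (0 : ℝ)).congr_of_eventuallyEq ?_
          filter_upwards [Ioi_mem_nhds h] with s hs
          exact ppart_of_nonpos (sub_nonpos.2 (le_of_lt hs))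
      refine (h1.mul h2).congr_deriv ?_
      simp only [hφ']
      ring
    · obtain ⟨Z, hZ⟩ := hζac.exists_bound
      rw [uIcc_of_le hαβ] at hZ
      have hu'm := hu.1.aestronglyMeasurable_deriv hαβ
      have hdom := integrable_abs_add_abs_rpow (by linarith : 0 ≤ p)
        (hu'm.const_mul (d - α))
        (aestronglyMeasurable_const (μ := volume.restrict (Ioo α β)) (b := Z))
        ((hu.const_mul (d - α)).1.2.2) (integrable_const _)
      refine hdom.mono' (aestronglyMeasurable_abs_rpow (by linarith) ?_)
        ((ae_restrict_iff' measurableSet_Ioo).2 (ae_of_all _ fun t ht => ?_))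
      · refine AEStronglyMeasurable.sub (AEStronglyMeasurable.mul ?_ ?_)
          (AEStronglyMeasurable.mul ?_ ?_)
        · exact (continuous_npart.comp_aestronglyMeasurable hu'm).indicator measurableSet_Ioi
        · exact hηlip.continuous.aestronglyMeasurable
        · have := hζac.continuousOn
          rw [uIcc_of_le hαβ] at this
          exact (this.mono Ioo_subset_Icc_self).aestronglyMeasurable measurableSet_Ioo
        · exact (measurable_one.indicator measurableSet_Iio).aestronglyMeasurable
      · rw [Real.norm_of_nonneg (by positivity)]
        refine Real.rpow_le_rpow (abs_nonneg _) ?_ (by linarith)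
        refine (abs_sub _ _).trans (add_le_add ?_ ?_)
        · rw [abs_mul, abs_mul, mul_comm]
          refine mul_le_mul ?_ (hwle t) (abs_nonneg _) (abs_nonneg _)
          rw [abs_of_nonneg (ppart_nonneg _), abs_of_nonneg (sub_nonneg.2 hdI.1)]
          exact max_le (by linarith [ht.1]) (sub_nonneg.2 hdI.1)
        · have h1 := hZ t (Ioo_subset_Icc_self ht)
          rw [Real.norm_eq_abs] at h1
          rw [abs_mul]
          refine (mul_le_of_le_one_right (abs_nonneg _) ?_).trans (h1.trans (le_abs_self Z))
          by_cases h : t ∈ Iio d <;> simp [h]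
    · simp [hζ]
    · have : η β = 0 := ppart_of_nonpos (sub_nonpos.2 hd.2)
      simp [this]
  have hneg : ∫ t in Ioo α β, c * ppart (u' t) ^ (p - 1) * φ' t ≤ 0 := by
    refine setIntegral_nonpos measurableSet_Ioo fun t ht => ?_
    have h1 : ppart (u' t) ^ (p - 1) * w t = 0 := by
      rcases le_total (u' t) 0 with h | h
      · rw [ppart_of_nonpos h, Real.zero_rpow (by linarith), zero_mul]
      · have : w t = 0 := by
          simp only [hw, npart_of_nonneg h, indicator_apply, ite_self]
        rw [this, mul_zero]
    have h2 : 0 ≤ c * ppart (u' t) ^ (p - 1) * (ζ t * (Iio d).indicator 1 t) :=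
      mul_nonneg (mul_nonneg hc (Real.rpow_nonneg (ppart_nonneg _) _))
        (mul_nonneg (hζ0 t ht.1.le) (indicator_nonneg (fun _ _ => zero_le_one) t))
    calc c * ppart (u' t) ^ (p - 1) * φ' t
        = c * (ppart (u' t) ^ (p - 1) * w t) * η t
          - c * ppart (u' t) ^ (p - 1) * (ζ t * (Iio d).indicator 1 t) := by
          simp only [hφ']; ring
      _ ≤ 0 := by rw [h1]; linarith
  have hposi : 0 < ∫ t in Ioo α β, |u t| ^ (p - 2) * u t * (ζ t * η t) := by
    have heq : ∫ t in Ioo α β, |u t| ^ (p - 2) * u t * (ζ t * η t)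
        = ∫ t in Ioo α β, ppart (u t) ^ (p - 1) * (ζ t * η t) := by
      refine setIntegral_congr_fun measurableSet_Ioo fun t ht => ?_
      rcases le_or_gt t t₀ with h | h
      · simp [hζleft t ⟨ht.1.le, h⟩]
      rcases lt_or_ge t d with h' | h'
      · simp only [abs_rpow_sub_two_mul_self (hdmin t ⟨h.le, h'⟩)]
      · have : η t = 0 := ppart_of_nonpos (sub_nonpos.2 h')
        simp [this]
    rw [heq, ← integral_Ioc_eq_integral_Ioo, ← intervalIntegral.integral_of_le hαβ]
    have hα : α < β := (ht₁I.1.trans_lt ht₁d).trans_le hd.2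
    refine intervalIntegral.integral_pos hα ?_ (fun t ht => ?_) ⟨t₁, ht₁I, ?_⟩
    · have := hζac.continuousOn
      rw [uIcc_of_le hαβ] at this
      exact (((continuous_ppart.rpow_const fun _ => Or.inr (by linarith)).comp_continuousOn huc).mul
        (this.mul hηlip.continuous.continuousOn))
    · exact mul_nonneg (Real.rpow_nonneg (ppart_nonneg _) _)
        (mul_nonneg (hζ0 t ht.1.le) (ppart_nonneg _))
    · have h1 : 0 < u t₁ := by linarith
      have h2 : 0 < η t₁ := by
        simp only [hη]
        rw [ppart_of_nonneg (by linarith)]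
        linarith
      rw [ppart_of_nonneg h1.le]
      positivity
  have := hEL _ _ hφ
  have := mul_pos hlam hposi
  linarith

end Degenerate

section Reflection

variable {p T : ℝ} {u u' : ℝ → ℝ}

lemma integral_Ioo_comp_neg (f : ℝ → ℝ) : ∫ t in Ioo (-T) T, f (-t) = ∫ t in Ioo (-T) T, f t := by
  rcases le_or_gt (-T) T with hT | hT
  · rw [← integral_Ioc_eq_integral_Ioo, ← integral_Ioc_eq_integral_Ioo,
      ← intervalIntegral.integral_of_le hT, ← intervalIntegral.integral_of_le hT,
      intervalIntegral.integral_comp_neg, neg_neg]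
  · simp [Ioo_eq_empty_of_le hT.le]

lemma MemW1p0.neg_comp_neg (h : MemW1p0 p (-T) T u u') (hT : 0 ≤ T) :
    MemW1p0 p (-T) T (fun t => -u (-t)) (fun t => u' (-t)) := by
  have hT' : -T ≤ T := by linarith
  have hi : ∀ {f : ℝ → ℝ}, IntervalIntegrable f volume (-T) T →
      IntervalIntegrable (fun t => f (-t)) volume (-T) T := fun hf => by
    have := (hf.comp_mul_left (c := -1)).symm
    simpa [div_neg] using this
  refine ⟨⟨hi h.1.1, fun t ht => ?_, ?_⟩, ?_, ?_⟩
  · have ht' : -t ∈ Icc (-T) T := ⟨by linarith [ht.2], by linarith [ht.1]⟩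
    have h1 := h.1.sub_eq ht' (right_mem_Icc.2 hT')
    have h2 := intervalIntegral.integral_comp_neg (a := -T) (b := t) u'
    rw [neg_neg] at h2
    simp only [neg_neg]
    rw [h2, ← h1]
    ring
  · rw [← intervalIntegrable_iff_integrableOn_Ioo_of_le hT']
    exact hi ((intervalIntegrable_iff_integrableOn_Ioo_of_le hT').2 h.1.2.2)
  · simp [h.2.2]
  · simp [h.2.1]

/-- The degenerate Euler–Lagrange equation has no nontrivial solution. -/
lemma eq_zero_of_degenerate_euler_lagrange (hp : 1 < p) (hT : 0 ≤ T) {c lam : ℝ} (hc : 0 < c)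
    (hlam : 0 ≤ lam) (hu : MemW1p0 p (-T) T u u')
    (hEL : ∀ φ φ', MemW1p0 p (-T) T φ φ' → ∫ t in Ioo (-T) T, c * ppart (u' t) ^ (p - 1) * φ' t
      = lam * ∫ t in Ioo (-T) T, |u t| ^ (p - 2) * u t * φ t) :
    ∀ t ∈ Icc (-T) T, u t = 0 := by
  have hT' : -T ≤ T := by linarith
  rcases hlam.eq_or_lt with rfl | hlam
  · have h0 := hEL u u' hu
    have hx : ∀ x : ℝ, ppart x ^ (p - 1) * x = asymPow p 1 0 x := fun x => by
      simp only [asymPow, one_mul, zero_mul, add_zero]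
      rcases le_or_gt x 0 with h | h
      · rw [ppart_of_nonpos h, Real.zero_rpow (by linarith), Real.zero_rpow (by linarith),
          zero_mul]
      · rw [ppart_of_nonneg h.le]
        nth_rw 2 [← Real.rpow_one x]
        rw [← Real.rpow_add h, sub_add_cancel]
    simp only [mul_assoc, hx, zero_mul, integral_const_mul, mul_eq_zero, hc.ne', false_or] at h0
    rw [integral_eq_zero_iff_of_nonneg (fun t => asymPow_nonneg zero_le_one le_rfl _)
      (hu.1.integrable_asymPow hT' (by linarith) zero_le_one le_rfl),
      EventuallyEq, ae_restrict_iff' measurableSet_Ioo] at h0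
    have hle : ∀ᵐ t, t ∈ Ioo (-T) T → u' t ≤ 0 := by
      filter_upwards [h0] with t ht htI
      by_contra! hpos
      have h1 := ht htI
      rw [← hx, ppart_of_nonneg hpos.le] at h1
      exact (mul_pos (Real.rpow_pos_of_pos hpos _) hpos).ne' h1
    have hmono : ∀ s ∈ Icc (-T) T, ∀ t ∈ Icc (-T) T, s ≤ t → u t ≤ u s := fun s hs t ht hst => by
      rw [← sub_nonpos, hu.1.sub_eq hs ht, intervalIntegral.integral_of_le hst,
        integral_Ioc_eq_integral_Ioo]
      refine setIntegral_nonpos_of_ae_restrict ?_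
      refine (ae_restrict_iff' measurableSet_Ioo).2 ?_
      filter_upwards [hle] with r hr hrI
      exact hr ⟨hs.1.trans_lt hrI.1, hrI.2.trans_le ht.2⟩
    intro t ht
    have h1 := hmono _ (left_mem_Icc.2 hT') t ht ht.1
    have h2 := hmono t ht _ (right_mem_Icc.2 hT') ht.2
    rw [hu.2.1] at h1
    rw [hu.2.2] at h2
    exact le_antisymm h1 h2
  · intro t ht
    refine le_antisymm (nonpos_of_degenerate_euler_lagrange hp hc.le hlam hu hEL ht) ?_
    have h1 := nonpos_of_degenerate_euler_lagrange hp hc.le hlam (hu.neg_comp_neg hT)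
      (fun φ φ' hφ => ?_) (t₀ := -t) ⟨by linarith [ht.2], by linarith [ht.1]⟩
    · simpa using h1
    · have h2 := hEL _ _ (hφ.neg_comp_neg hT)
      have h3 := integral_Ioo_comp_neg (T := T)
        (fun t => c * ppart (u' t) ^ (p - 1) * φ' (-t))
      have h4 := integral_Ioo_comp_neg (T := T)
        (fun t => |u t| ^ (p - 2) * u t * -φ (-t))
      rw [← h3, ← h4] at h2
      simpa using h2

end Reflection

/-! ### Compactness of bounded sets -/

section Compactness

variable {p α β C : ℝ} {u u' : ℝ → ℝ}

lemma le_add_rpow_mul_rpow (hp : 1 < p) {M v : ℝ} (hM : 0 < M) (hv : 0 ≤ v) :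
    v ≤ M + M ^ (1 - p) * v ^ p := by
  have h0 : 0 ≤ M ^ (1 - p) * v ^ p := by positivity
  rcases le_or_gt v M with h | h
  · linarith
  · have hv : 0 < v := hM.trans h
    have h1 : v ^ (1 - p) * v ^ p = v := by
      rw [← Real.rpow_add hv, sub_add_cancel, Real.rpow_one]
    have h2 := mul_le_mul_of_nonneg_right
      (Real.rpow_le_rpow_of_nonpos hM h.le (by linarith : 1 - p ≤ 0)) (Real.rpow_nonneg hv.le p)
    linarith

lemma uIoc_subset_Ioc {s t : ℝ} (hs : s ∈ Icc α β) (ht : t ∈ Icc α β) : uIoc s t ⊆ Ioc α β :=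
  Ioc_subset_Ioc (le_min hs.1 ht.1) (max_le hs.2 ht.2)

lemma MemW1pC.dist_le (hp : 1 < p) (h : MemW1pC p α β u u') {M : ℝ} (hM : 0 < M) {s t : ℝ}
    (hs : s ∈ Icc α β) (ht : t ∈ Icc α β) :
    dist (u s) (u t) ≤ M * dist s t + M ^ (1 - p) * ∫ r in uIoc s t, |u' r| ^ p := by
  have hsub := uIoc_subset_Ioc hs ht
  have hip : IntegrableOn (fun r => |u' r| ^ p) (uIoc s t) volume :=
    ((integrableOn_Ioc_iff_integrableOn_Ioo (by simp)).2 h.2.2).mono_set hsub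
  have hfin : volume (uIoc s t) ≠ ⊤ := by simp [uIoc]
  have hc : IntegrableOn (fun _ => M) (uIoc s t) volume := integrableOn_const hfin
  rw [dist_comm, Real.dist_eq, h.sub_eq hs ht, intervalIntegral.abs_intervalIntegral_eq]
  calc |∫ r in uIoc s t, u' r| ≤ ∫ r in uIoc s t, |u' r| := abs_integral_le_integral_abs
    _ ≤ ∫ r in uIoc s t, (M + M ^ (1 - p) * |u' r| ^ p) := by
        refine integral_mono ((h.1.1.mono_set hsub).abs) (hc.add (hip.const_mul _)) fun r => ?_
        exact le_add_rpow_mul_rpow hp hM (abs_nonneg _)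
    _ = _ := by
        rw [integral_add hc (hip.const_mul _), integral_const_mul, setIntegral_const,
          Real.dist_eq, abs_sub_comm, smul_eq_mul, mul_comm M]
        simp [measureReal_def, uIoc, max_sub_min_eq_abs]

lemma exists_rpow_mul_lt (hp : 1 < p) (C : ℝ) {ε : ℝ} (hε : 0 < ε) :
    ∃ M, 0 < M ∧ M ^ (1 - p) * C < ε := by
  have h := (tendsto_rpow_neg_atTop (by linarith : 0 < p - 1)).mul_const C
  rw [zero_mul, neg_sub] at h
  obtain ⟨M, hM, hM0⟩ := ((h.eventually_lt_const hε).and (eventually_gt_atTop 0)).exists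
  exact ⟨M, hM0, hM⟩

open AbsolutelyContinuousOnInterval in
/-- Functions with uniformly bounded energy are uniformly absolutely continuous. -/
lemma exists_forall_sum_dist_lt (hp : 1 < p) (hαβ : α ≤ β) (C : ℝ) {ε : ℝ} (hε : 0 < ε) :
    ∃ δ > 0, ∀ u u', MemW1pC p α β u u' → ∫ t in Ioo α β, |u' t| ^ p ≤ C →
      ∀ E ∈ disjWithin α β, ∑ i ∈ Finset.range E.1, dist (E.2 i).1 (E.2 i).2 < δ →
        ∑ i ∈ Finset.range E.1, dist (u (E.2 i).1) (u (E.2 i).2) < ε := by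
  obtain ⟨M, hM, hMC⟩ := exists_rpow_mul_lt hp C (half_pos hε)
  refine ⟨ε / (2 * M), by positivity, fun u u' hu hC E hE hEδ => ?_⟩
  have hI : ∀ i ∈ Finset.range E.1, (E.2 i).1 ∈ Icc α β ∧ (E.2 i).2 ∈ Icc α β := by
    have := hE.1
    rwa [uIcc_of_le hαβ] at this
  have hsub : ∀ i ∈ Finset.range E.1, uIoc (E.2 i).1 (E.2 i).2 ⊆ Ioc α β := fun i hi =>
    uIoc_subset_Ioc (hI i hi).1 (hI i hi).2
  have hip : IntegrableOn (fun r => |u' r| ^ p) (Ioc α β) volume :=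
    (integrableOn_Ioc_iff_integrableOn_Ioo (by simp)).2 hu.2.2
  have hsum : ∑ i ∈ Finset.range E.1, ∫ r in uIoc (E.2 i).1 (E.2 i).2, |u' r| ^ p ≤ C := by
    rw [← integral_biUnion_finset _ (fun i _ => measurableSet_uIoc) hE.2
      fun i hi => hip.mono_set (hsub i hi)]
    refine (setIntegral_mono_set hip (ae_of_all _ fun r => by positivity)
      (iUnion₂_subset hsub).eventuallyLE).trans ?_
    rwa [integral_Ioc_eq_integral_Ioo]
  calc ∑ i ∈ Finset.range E.1, dist (u (E.2 i).1) (u (E.2 i).2)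
      ≤ ∑ i ∈ Finset.range E.1, (M * dist (E.2 i).1 (E.2 i).2
          + M ^ (1 - p) * ∫ r in uIoc (E.2 i).1 (E.2 i).2, |u' r| ^ p) :=
        Finset.sum_le_sum fun i hi => hu.dist_le hp hM (hI i hi).1 (hI i hi).2
    _ = M * ∑ i ∈ Finset.range E.1, dist (E.2 i).1 (E.2 i).2
          + M ^ (1 - p) * ∑ i ∈ Finset.range E.1, ∫ r in uIoc (E.2 i).1 (E.2 i).2, |u' r| ^ p := by
        rw [Finset.sum_add_distrib, Finset.mul_sum, Finset.mul_sum]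
    _ < ε / 2 + ε / 2 := by
        refine add_lt_add ?_
          ((mul_le_mul_of_nonneg_left hsum (Real.rpow_nonneg hM.le _)).trans_lt hMC)
        rw [lt_div_iff₀ (by positivity)] at hEδ
        linarith
    _ = ε := add_halves ε

lemma MemW1p0.abs_le (hp : 1 < p) (hu : MemW1p0 p α β u u')
    (hC : ∫ t in Ioo α β, |u' t| ^ p ≤ C) {t : ℝ} (ht : t ∈ Icc α β) :
    |u t| ≤ (β - α) + C := by
  have hα : α ∈ Icc α β := left_mem_Icc.2 (ht.1.trans ht.2)
  have h := hu.1.dist_le hp one_pos ht hα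
  rw [hu.2.1, Real.dist_eq, sub_zero, Real.one_rpow, one_mul, one_mul, Real.dist_eq,
    abs_of_nonneg (sub_nonneg.2 ht.1)] at h
  have h2 : ∫ r in uIoc t α, |u' r| ^ p ≤ ∫ r in Ioc α β, |u' r| ^ p :=
    setIntegral_mono_set ((integrableOn_Ioc_iff_integrableOn_Ioo (by simp)).2 hu.1.2.2)
      (ae_of_all _ fun r => by positivity) (uIoc_subset_Ioc ht hα).eventuallyLE
  rw [integral_Ioc_eq_integral_Ioo] at h2
  linarith [ht.2]

open AbsolutelyContinuousOnInterval in
/-- Arzelà–Ascoli for sequences with bounded energy. -/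
lemma exists_subseq_tendsto (hp : 1 < p) (hαβ : α ≤ β) {u u' : ℕ → ℝ → ℝ}
    (hu : ∀ n, MemW1p0 p α β (u n) (u' n)) (hC : ∀ n, ∫ t in Ioo α β, |u' n t| ^ p ≤ C) :
    ∃ v : ℝ → ℝ, Continuous v ∧ AbsolutelyContinuousOnInterval v α β ∧
      ∃ σ : ℕ → ℕ, StrictMono σ ∧
        ∀ t ∈ Icc α β, Tendsto (fun n => u (σ n) t) atTop (𝓝 (v t)) := by
  let F : ℕ → BoundedContinuousFunction (Icc α β) ℝ := fun n =>
    BoundedContinuousFunction.mkOfCompact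
      ⟨(Icc α β).domRestrict (u n), ((hu n).1.continuousOn hαβ).domRestrict⟩
  have hF : ∀ n (t : Icc α β), F n t = u n t := fun n t => rfl
  have hcomp : IsCompact (closure (range F)) := by
    refine BoundedContinuousFunction.arzela_ascoli (Icc (-((β - α) + C)) ((β - α) + C))
      isCompact_Icc _ ?_ ?_
    · rintro _ t ⟨n, rfl⟩
      exact abs_le.1 ((hu n).abs_le hp (hC n) t.2)
    · intro t
      rw [Metric.equicontinuousAt_iff]
      intro ε hε
      obtain ⟨δ, hδ, H⟩ := exists_forall_sum_dist_lt hp hαβ C hε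
      refine ⟨δ, hδ, fun s hs f => ?_⟩
      obtain ⟨_, n, rfl⟩ := f
      have := H _ _ (hu n).1 (hC n) (1, fun _ => (t.1, s.1))
        ⟨fun i _ => by rw [uIcc_of_le hαβ]; exact ⟨t.2, s.2⟩, by simp⟩
        (by simpa [dist_comm, Subtype.dist_eq] using hs)
      simpa [hF] using this
  obtain ⟨f, -, σ, hσ, hlim⟩ := hcomp.tendsto_subseq fun n => subset_closure (mem_range_self n)
  have hpt : ∀ t ∈ Icc α β, Tendsto (fun n => u (σ n) t) atTop (𝓝 (IccExtend hαβ f t)) := by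
    intro t ht
    rw [IccExtend_of_mem hαβ f ht]
    exact (((continuous_apply (⟨t, ht⟩ : Icc α β)).comp
      BoundedContinuousFunction.continuous_coe).tendsto f).comp hlim
  refine ⟨IccExtend hαβ f, f.continuous.Icc_extend', ?_, σ, hσ, hpt⟩
  rw [absolutelyContinuousOnInterval_iff]
  intro ε hε
  obtain ⟨δ, hδ, H⟩ := exists_forall_sum_dist_lt hp hαβ C (half_pos hε)
  refine ⟨δ, hδ, fun E hE hEδ => ?_⟩
  have hI := hE.1
  rw [uIcc_of_le hαβ] at hI
  refine lt_of_le_of_lt ?_ (half_lt_self hε)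
  refine le_of_tendsto (tendsto_finsetSum _ fun i hi =>
    (hpt _ (hI i hi).1).dist (hpt _ (hI i hi).2)) (Eventually.of_forall fun n => ?_)
  exact (H _ _ (hu (σ n)).1 (hC _) E hE hEδ).le

end Compactness

/-! ### Lower semicontinuity of the energy -/

section LowerSemicontinuity

variable {p a b α β h L B : ℝ} {u u' : ℝ → ℝ}

lemma asymPow_differenceQuotient_le (hp : 1 < p) (ha : 0 ≤ a) (hb : 0 ≤ b)
    (hu : MemW1pC p α β u u') (hh : 0 < h) {t : ℝ} (ht : t ∈ Icc α (β - h)) :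
    asymPow p a b (h⁻¹ * (u (t + h) - u t)) ≤
      h⁻¹ * ((∫ s in α..t + h, asymPow p a b (u' s)) - ∫ s in α..t, asymPow p a b (u' s)) := by
  have hp0 : 0 < p := by linarith
  have htI : t ∈ Icc α β := ⟨ht.1, by linarith [ht.2]⟩
  have hthI : t + h ∈ Icc α β := ⟨by linarith [ht.1], by linarith [ht.2]⟩
  have hαβ : α ≤ β := htI.1.trans htI.2
  have hsub : Ioc t (t + h) ⊆ Ioc α β := Ioc_subset_Ioc htI.1 hthI.2
  have hK : IntervalIntegrable (fun s => asymPow p a b (u' s)) volume α β :=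
    (intervalIntegrable_iff_integrableOn_Ioo_of_le hαβ).2 (hu.integrable_asymPow hαβ hp0 ha hb)
  have hKi : ∀ s ∈ Icc α β, IntervalIntegrable (fun s => asymPow p a b (u' s)) volume α s :=
    fun s hs => hK.mono_set (by
      rw [uIcc_of_le hαβ, uIcc_of_le hs.1]; exact Icc_subset_Icc_right hs.2)
  have hJ := (convexOn_asymPow hp.le ha hb).map_set_average_le (μ := volume)
    (t := Ioc t (t + h)) (f := u') (continuous_asymPow hp0.le).continuousOn isClosed_univ
    (by simp [hh]) (by simp) (ae_of_all _ fun _ => mem_univ _) (hu.1.1.mono_set hsub)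
    (hK.1.mono_set hsub)
  rw [setAverage_eq, setAverage_eq, Real.volume_real_Ioc_of_le (by linarith), smul_eq_mul,
    smul_eq_mul, add_sub_cancel_left, ← intervalIntegral.integral_of_le (by linarith),
    ← intervalIntegral.integral_of_le (by linarith), ← hu.sub_eq htI hthI] at hJ
  rwa [intervalIntegral.integral_interval_sub_left (hKi _ hthI) (hKi _ htI)]

lemma integral_asymPow_differenceQuotient_le (hp : 1 < p) (ha : 0 ≤ a) (hb : 0 ≤ b)
    (hu : MemW1pC p α β u u') (hh : 0 < h) (hhβ : h ≤ β - α) :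
    ∫ t in α..β - h, asymPow p a b (h⁻¹ * (u (t + h) - u t)) ≤
      ∫ t in Ioo α β, asymPow p a b (u' t) := by
  have hp0 : 0 < p := by linarith
  have hαβ : α ≤ β := by linarith
  have hK : IntervalIntegrable (fun s => asymPow p a b (u' s)) volume α β :=
    (intervalIntegrable_iff_integrableOn_Ioo_of_le hαβ).2 (hu.integrable_asymPow hαβ hp0 ha hb)
  set Φ : ℝ → ℝ := fun t => ∫ s in α..t, asymPow p a b (u' s) with hΦ
  have hΦc : ContinuousOn Φ (Icc α β) := by
    have := intervalIntegral.continuousOn_primitive_interval' hK left_mem_uIcc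
    rwa [uIcc_of_le hαβ] at this
  have hΦi : ∀ s ∈ Icc α β, ∀ t ∈ Icc α β, IntervalIntegrable Φ volume s t := fun s hs t ht =>
    (hΦc.mono (uIcc_subset_Icc hs ht)).intervalIntegrable
  have hΦ0 : ∀ t ∈ Icc α β, 0 ≤ Φ t := fun t ht =>
    intervalIntegral.integral_nonneg ht.1 fun s _ => asymPow_nonneg ha hb _
  have hΦle : ∀ t ∈ Icc α β, Φ t ≤ Φ β := fun t ht =>
    intervalIntegral.integral_mono_interval le_rfl ht.1 ht.2
      (ae_of_all _ fun s => asymPow_nonneg ha hb _) hK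
  have hα : α ∈ Icc α β := left_mem_Icc.2 hαβ
  have hβ : β ∈ Icc α β := right_mem_Icc.2 hαβ
  have hβh : β - h ∈ Icc α β := ⟨by linarith, by linarith⟩
  have hαh : α + h ∈ Icc α β := ⟨by linarith, by linarith⟩
  have hmaps : MapsTo (fun t => t + h) (Icc α (β - h)) (Icc α β) := fun t ht =>
    ⟨by linarith [ht.1], by linarith [ht.2]⟩
  have hcs : ContinuousOn (fun t => t + h) (Icc α (β - h)) := by fun_prop
  have hsubI : Icc α (β - h) ⊆ Icc α β := Icc_subset_Icc_right (by linarith)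
  have hΦhi : IntervalIntegrable (fun t => Φ (t + h)) volume α (β - h) := by
    refine ContinuousOn.intervalIntegrable ?_
    rw [uIcc_of_le hβh.1]
    exact hΦc.comp hcs hmaps
  have huc := hu.continuousOn hαβ
  calc ∫ t in α..β - h, asymPow p a b (h⁻¹ * (u (t + h) - u t))
      ≤ ∫ t in α..β - h, h⁻¹ * (Φ (t + h) - Φ t) := by
        refine intervalIntegral.integral_mono_on hβh.1 ?_
          ((hΦhi.sub (hΦi _ hα _ hβh)).const_mul _)
          fun t ht => asymPow_differenceQuotient_le hp ha hb hu hh ht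
        refine ContinuousOn.intervalIntegrable ?_
        rw [uIcc_of_le hβh.1]
        exact (continuous_asymPow hp0.le).comp_continuousOn
          (continuousOn_const.mul ((huc.comp hcs hmaps).sub (huc.mono hsubI)))
    _ = h⁻¹ * ((∫ t in β - h..β, Φ t) - ∫ t in α..α + h, Φ t) := by
        rw [intervalIntegral.integral_const_mul,
          intervalIntegral.integral_sub hΦhi (hΦi _ hα _ hβh),
          intervalIntegral.integral_comp_add_right, sub_add_cancel]
        have h1 := intervalIntegral.integral_add_adjacent_intervals (hΦi _ hα _ hαh)
          (hΦi _ hαh _ hβ)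
        have h2 := intervalIntegral.integral_add_adjacent_intervals (hΦi _ hα _ hβh)
          (hΦi _ hβh _ hβ)
        congr 1
        linarith
    _ ≤ h⁻¹ * (h * Φ β) := by
        refine mul_le_mul_of_nonneg_left ?_ (inv_nonneg.2 hh.le)
        have h1 : 0 ≤ ∫ t in α..α + h, Φ t :=
          intervalIntegral.integral_nonneg (by linarith) fun t ht =>
            hΦ0 t ⟨ht.1, ht.2.trans hαh.2⟩
        have h2 : ∫ t in β - h..β, Φ t ≤ ∫ _ in β - h..β, Φ β :=
          intervalIntegral.integral_mono_on (by linarith) (hΦi _ hβh _ hβ)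
            intervalIntegrable_const fun t ht => hΦle t ⟨hβh.1.trans ht.1, ht.2⟩
        rw [intervalIntegral.integral_const, sub_sub_cancel, smul_eq_mul] at h2
        linarith
    _ = ∫ t in Ioo α β, asymPow p a b (u' t) := by
        rw [inv_mul_cancel_left₀ hh.ne']
        simp only [hΦ]
        rw [intervalIntegral.integral_of_le hαβ,
          integral_Ioc_eq_integral_Ioo]

/-- The energy is lower semicontinuous under bounded pointwise convergence. -/
lemma lintegral_asymPow_deriv_le (hp : 1 < p) (ha : 0 ≤ a) (hb : 0 ≤ b) (hαβ : α < β)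
    {u u' : ℕ → ℝ → ℝ} (hu : ∀ n, MemW1pC p α β (u n) (u' n))
    (hB : ∀ n, ∀ t ∈ Icc α β, |u n t| ≤ B)
    (hL : Tendsto (fun n => ∫ t in Ioo α β, asymPow p a b (u' n t)) atTop (𝓝 L))
    {v : ℝ → ℝ} (hvc : Continuous v) (hvac : AbsolutelyContinuousOnInterval v α β)
    (hv : ∀ t ∈ Icc α β, Tendsto (fun n => u n t) atTop (𝓝 (v t))) :
    ∫⁻ t in Ioo α β, ENNReal.ofReal (asymPow p a b (deriv v t)) ≤ ENNReal.ofReal L := by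
  have hp0 : 0 < p := by linarith
  have hKc := continuous_asymPow (a := a) (b := b) hp0.le
  have hquot : ∀ h, 0 < h → h ≤ β - α →
      ∫ t in α..β - h, asymPow p a b (h⁻¹ * (v (t + h) - v t)) ≤ L := by
    intro h hh hhβ
    have hmaps : ∀ t ∈ Ioc α (β - h), t ∈ Icc α β ∧ t + h ∈ Icc α β := fun t ht =>
      ⟨⟨ht.1.le, by linarith [ht.2]⟩, ⟨by linarith [ht.1], by linarith [ht.2]⟩⟩
    have hle : α ≤ β - h := by linarith
    refine le_of_tendsto_of_tendsto ?_ hL (Eventually.of_forall fun n =>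
      integral_asymPow_differenceQuotient_le hp ha hb (hu n) hh hhβ)
    refine intervalIntegral.tendsto_integral_filter_of_dominated_convergence
      (fun _ => (a ^ p + b ^ p) * (h⁻¹ * (B + B)) ^ p) (Eventually.of_forall fun n => ?_)
      (Eventually.of_forall fun n => ae_of_all _ fun t ht => ?_) intervalIntegrable_const
      (ae_of_all _ fun t ht => ?_)
    · rw [uIoc_of_le hle]
      have huc := (hu n).continuousOn hαβ.le
      refine ContinuousOn.aestronglyMeasurable (hKc.comp_continuousOn
        (continuousOn_const.mul ((huc.comp (by fun_prop) fun t ht => (hmaps t ht).2).sub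
        (huc.mono fun t ht => (hmaps t ht).1)))) measurableSet_Ioc
    · rw [uIoc_of_le hle] at ht
      rw [Real.norm_of_nonneg (asymPow_nonneg ha hb _)]
      refine (asymPow_le hp0 ha hb _).trans (mul_le_mul_of_nonneg_left ?_
        (add_nonneg (Real.rpow_nonneg ha p) (Real.rpow_nonneg hb p)))
      refine Real.rpow_le_rpow (abs_nonneg _) ?_ hp0.le
      rw [abs_mul, abs_of_pos (inv_pos.2 hh)]
      exact mul_le_mul_of_nonneg_left ((abs_sub _ _).trans
        (add_le_add (hB n _ (hmaps t ht).2) (hB n _ (hmaps t ht).1))) (inv_nonneg.2 hh.le)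
    · rw [uIoc_of_le hle] at ht
      exact (hKc.tendsto _).comp (((hv _ (hmaps t ht).2).sub (hv _ (hmaps t ht).1)).const_mul _)
  let h : ℕ → ℝ := fun k => (β - α) * (1 / ((k : ℝ) + 1))
  have hh0 : ∀ k, 0 < h k := fun k => mul_pos (sub_pos.2 hαβ) Nat.one_div_pos_of_nat
  have hhβ : ∀ k, h k ≤ β - α := fun k => by
    refine mul_le_of_le_one_right (sub_pos.2 hαβ).le ?_
    rw [div_le_one (by positivity)]
    simp
  have hhlim : Tendsto h atTop (𝓝 0) := by
    simpa [h] using tendsto_one_div_add_atTop_nhds_zero_nat.const_mul (β - α)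
  have hhlim' : Tendsto h atTop (𝓝[>] 0) :=
    tendsto_nhdsWithin_iff.2 ⟨hhlim, Eventually.of_forall hh0⟩
  let f : ℕ → ℝ → ENNReal := fun k => (Ioc α (β - h k)).indicator fun t =>
    ENNReal.ofReal (asymPow p a b ((h k)⁻¹ * (v (t + h k) - v t)))
  have hgc : ∀ k, Continuous fun t => asymPow p a b ((h k)⁻¹ * (v (t + h k) - v t)) := fun k =>
    hKc.comp (by fun_prop)
  have hfm : ∀ k, Measurable (f k) := fun k =>
    (hgc k).measurable.ennreal_ofReal.indicator measurableSet_Ioc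
  have hfL : ∀ k, ∫⁻ t in Ioo α β, f k t ≤ ENNReal.ofReal L := fun k => by
    have hle : α ≤ β - h k := by linarith [hhβ k]
    calc ∫⁻ t in Ioo α β, f k t ≤ ∫⁻ t, f k t := setLIntegral_le_lintegral _ _
      _ = ∫⁻ t in Ioc α (β - h k),
            ENNReal.ofReal (asymPow p a b ((h k)⁻¹ * (v (t + h k) - v t))) :=
          lintegral_indicator measurableSet_Ioc _
      _ = ENNReal.ofReal (∫ t in Ioc α (β - h k),
            asymPow p a b ((h k)⁻¹ * (v (t + h k) - v t))) :=
          (ofReal_integral_eq_lintegral_ofReal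
            ((hgc k).integrableOn_Icc.mono_set Ioc_subset_Icc_self)
            (ae_of_all _ fun t => asymPow_nonneg ha hb _)).symm
      _ ≤ ENNReal.ofReal L := by
          rw [← intervalIntegral.integral_of_le hle]
          exact ENNReal.ofReal_le_ofReal (hquot _ (hh0 k) (hhβ k))
  have hlim : ∀ᵐ t ∂volume.restrict (Ioo α β),
      ENNReal.ofReal (asymPow p a b (deriv v t)) = liminf (fun k => f k t) atTop := by
    refine (ae_restrict_iff' measurableSet_Ioo).2 ?_
    filter_upwards [hvac.ae_differentiableAt] with t ht htI
    rw [uIcc_of_le hαβ.le] at ht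
    have hd := (ht (Ioo_subset_Icc_self htI)).hasDerivAt.tendsto_slope_zero_right.comp hhlim'
    refine (Tendsto.liminf_eq (Tendsto.congr' ?_
      ((ENNReal.continuous_ofReal.comp hKc).continuousAt.tendsto.comp hd))).symm
    filter_upwards [hhlim.eventually_lt_const (sub_pos.2 htI.2)] with k hk
    rw [show f k t = _ from indicator_of_mem (show t ∈ Ioc α (β - h k) from
      ⟨htI.1, by linarith⟩) _]
    rfl
  rw [lintegral_congr_ae hlim]
  refine (lintegral_liminf_le hfm).trans ?_
  refine (liminf_le_liminf (Eventually.of_forall hfL)).trans ?_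
  simp

end LowerSemicontinuity

/-! ### Existence of minimizers -/

section Existence

variable {p a b T : ℝ}

lemma memW1p0_tent (hT : 0 ≤ T) (hp : 0 ≤ p) :
    MemW1p0 p (-T) T (fun t => T - |t|) (deriv fun t => T - |t|) := by
  have hT' : -T ≤ T := by linarith
  have hlip : LipschitzWith 1 fun t : ℝ => T - |t| := by
    refine LipschitzWith.of_dist_le_mul fun x y => ?_
    rw [NNReal.coe_one, one_mul, Real.dist_eq, Real.dist_eq, sub_sub_sub_cancel_left, abs_sub_comm]
    exact abs_abs_sub_abs_le _ _
  refine ⟨MemW1pC.of_absolutelyContinuousOnInterval hT'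
    hlip.lipschitzOnWith.absolutelyContinuousOnInterval ?_ ?_, by simp [abs_of_nonneg hT],
    by simp [abs_of_nonneg hT]⟩
  · have hne : ∀ᵐ t : ℝ, t ≠ 0 := by simp [ae_iff]
    filter_upwards [hne] with t ht _
    exact ((hasDerivAt_abs ht).const_sub T).differentiableAt.hasDerivAt
  · have hc : IntegrableOn (fun _ : ℝ => (1 : ℝ)) (Ioo (-T) T) volume := integrableOn_const (by simp)
    refine hc.mono' (aestronglyMeasurable_abs_rpow hp (measurable_deriv _).aestronglyMeasurable)
      (ae_of_all _ fun t => ?_)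
    rw [Real.norm_of_nonneg (by positivity)]
    exact Real.rpow_le_one (abs_nonneg _) (by simpa using norm_deriv_le_of_lipschitz hlip) hp

/-- The infimum is attained when both coefficients are positive. -/
lemma exists_minimizer (hp : 1 < p) (hT : 0 < T) (ha : 0 < a) (hb : 0 < b) :
    ∃ u u', MemW1p0 p (-T) T u u' ∧ ∫ t in Ioo (-T) T, |u t| ^ p = 1 ∧
      ∫ t in Ioo (-T) T, asymPow p a b (u' t) = lamAB p a b (-T) T := by
  have hp0 : 0 < p := by linarith
  have hT' : -T < T := by linarith
  have hne : { E | ∃ u u', MemW1p0 p (-T) T u u' ∧ (∫ t in Ioo (-T) T, |u t| ^ p) = 1 ∧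
      E = ∫ t in Ioo (-T) T, asymPow p a b (u' t) }.Nonempty := by
    have htent := memW1p0_tent (p := p) hT.le hp0.le
    have hpos : 0 < ∫ t in Ioo (-T) T, |(T - |t|)| ^ p := by
      rw [← integral_Ioc_eq_integral_Ioo, ← intervalIntegral.integral_of_le hT'.le]
      refine intervalIntegral.integral_pos hT' ?_ (fun t _ => by positivity)
        ⟨0, ⟨by linarith, hT.le⟩, ?_⟩
      · exact ((continuous_const.sub continuous_abs).abs.rpow_const
          fun _ => Or.inr hp0.le).continuousOn
      · rw [abs_zero, sub_zero, abs_of_pos hT]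
        positivity
    obtain ⟨c, -, -, h1, h2⟩ := htent.normalize hp0 hpos
    exact ⟨_, _, _, h1, h2, rfl⟩
  have hbdd : BddBelow { E | ∃ u u', MemW1p0 p (-T) T u u' ∧ (∫ t in Ioo (-T) T, |u t| ^ p) = 1 ∧
      E = ∫ t in Ioo (-T) T, asymPow p a b (u' t) } := by
    refine ⟨0, ?_⟩
    rintro _ ⟨u, u', -, -, rfl⟩
    exact integral_nonneg fun t => asymPow_nonneg ha.le hb.le _
  obtain ⟨E, -, hElim, hEmem⟩ := exists_seq_tendsto_sInf hne hbdd
  choose u u' hu hN hE using hEmem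
  change Tendsto E atTop (𝓝 (lamAB p a b (-T) T)) at hElim
  have hm : 0 < min a b := lt_min ha hb
  obtain ⟨D, hD⟩ := hElim.bddAbove_range
  have hcoer : ∀ {w : ℝ → ℝ} (t : ℝ), |w t| ^ p ≤ ((min a b) ^ p)⁻¹ * asymPow p a b (w t) :=
    fun {w} t => by
      rw [← div_eq_inv_mul, le_div_iff₀ (by positivity), mul_comm]
      exact le_asymPow hp0.le hm.le (min_le_left _ _) (min_le_right _ _) _
  have hC : ∀ n, ∫ t in Ioo (-T) T, |u' n t| ^ p ≤ ((min a b) ^ p)⁻¹ * D := fun n => by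
    have hi := (hu n).1.integrable_asymPow hT'.le hp0 ha.le hb.le
    refine (integral_mono (hu n).1.2.2 (hi.const_mul _) fun t => hcoer t).trans ?_
    rw [integral_const_mul, ← hE n]
    exact mul_le_mul_of_nonneg_left (hD (mem_range_self n)) (by positivity)
  obtain ⟨v, hvc, hvac, σ, hσ, hv⟩ := exists_subseq_tendsto hp hT'.le hu hC
  set B : ℝ := (T - -T) + ((min a b) ^ p)⁻¹ * D with hBdef
  have hB : ∀ n, ∀ t ∈ Icc (-T) T, |u n t| ≤ B := fun n t ht => (hu n).abs_le hp (hC n) ht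
  have hL := lintegral_asymPow_deriv_le (L := lamAB p a b (-T) T) hp ha.le hb.le hT'
    (fun n => (hu (σ n)).1) (fun n => hB (σ n))
    ((hElim.comp hσ.tendsto_atTop).congr fun n => hE (σ n)) hvc hvac hv
  have hKm : AEStronglyMeasurable (fun t => asymPow p a b (deriv v t))
      (volume.restrict (Ioo (-T) T)) :=
    (continuous_asymPow hp0.le).comp_aestronglyMeasurable
      (measurable_deriv v).aestronglyMeasurable
  have hK0 : ∀ t, 0 ≤ asymPow p a b (deriv v t) := fun t => asymPow_nonneg ha.le hb.le _
  have hKi : IntegrableOn (fun t => asymPow p a b (deriv v t)) (Ioo (-T) T) volume :=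
    (lintegral_ofReal_ne_top_iff_integrable hKm (ae_of_all _ hK0)).1
      (hL.trans_lt ENNReal.ofReal_lt_top).ne
  have hv1 : MemW1p0 p (-T) T v (deriv v) := by
    refine ⟨MemW1pC.of_absolutelyContinuousOnInterval hT'.le hvac ?_ ?_, ?_, ?_⟩
    · filter_upwards [hvac.ae_differentiableAt] with t ht htI
      rw [uIcc_of_le hT'.le] at ht
      exact (ht htI).hasDerivAt
    · refine (hKi.const_mul ((min a b) ^ p)⁻¹).mono'
        (aestronglyMeasurable_abs_rpow hp0.le (measurable_deriv v).aestronglyMeasurable)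
        (ae_of_all _ fun t => ?_)
      rw [Real.norm_of_nonneg (by positivity)]
      exact hcoer t
    · refine tendsto_nhds_unique (hv _ (left_mem_Icc.2 hT'.le)) ?_
      simp only [(hu _).2.1, tendsto_const_nhds]
    · refine tendsto_nhds_unique (hv _ (right_mem_Icc.2 hT'.le)) ?_
      simp only [(hu _).2.2, tendsto_const_nhds]
  have hvN : ∫ t in Ioo (-T) T, |v t| ^ p = 1 := by
    have hlim : Tendsto (fun n => ∫ t in Ioo (-T) T, |u (σ n) t| ^ p) atTop
        (𝓝 (∫ t in Ioo (-T) T, |v t| ^ p)) := by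
      refine tendsto_integral_of_dominated_convergence (fun _ => B ^ p)
        (fun n => aestronglyMeasurable_abs_rpow hp0.le
          ((hu (σ n)).1.aestronglyMeasurable hT'.le)) (integrable_const _)
        (fun n => (ae_restrict_iff' measurableSet_Ioo).2 (ae_of_all _ fun t ht => ?_))
        ((ae_restrict_iff' measurableSet_Ioo).2 (ae_of_all _ fun t ht => ?_))
      · rw [Real.norm_of_nonneg (by positivity)]
        exact Real.rpow_le_rpow (abs_nonneg _) (hB _ _ (Ioo_subset_Icc_self ht)) hp0.le
      · exact (hv t (Ioo_subset_Icc_self ht)).abs.rpow_const (Or.inr hp0.le)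
    simp only [hN] at hlim
    exact tendsto_nhds_unique hlim tendsto_const_nhds
  refine ⟨v, deriv v, hv1, hvN, le_antisymm ?_ (lamAB_le ha.le hb.le hv1 hvN)⟩
  rw [integral_eq_lintegral_of_nonneg_ae (ae_of_all _ hK0) hKm]
  exact ENNReal.toReal_le_of_le_ofReal (lamAB_nonneg ha.le hb.le) hL

end Existence

end

noncomputable section

theorem lamAB_attained_iff (p T a b : ℝ) (hp : 1 < p) (hT : 0 < T) (ha : 0 < a) (hb : 0 ≤ b) :
    ((∃ u u', MemW1p0 p (-T) T u u' ∧ (∫ t in Set.Ioo (-T) T, |u t| ^ p) = 1 ∧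
        (∫ t in Set.Ioo (-T) T, (a * ppart (u' t) + b * npart (u' t)) ^ p)
          = lamAB p a b (-T) T) ↔ 0 < b) ∧
    ((∃ u u', MemW1p0 p (-T) T u u' ∧ (¬ ∀ t ∈ Set.Ioo (-T) T, u t = 0) ∧
        ∀ φ φ', MemW1p0 p (-T) T φ φ' →
          (∫ t in Set.Ioo (-T) T,
              (a ^ p * ppart (u' t) ^ (p - 1) - b ^ p * npart (u' t) ^ (p - 1)) * φ' t)
            = lamAB p a b (-T) T * ∫ t in Set.Ioo (-T) T, |u t| ^ (p - 2) * u t * φ t)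
      ↔ 0 < b) := by
  have hT' : -T ≤ T := by linarith
  have hp0 : p ≠ 0 := by linarith
  have hEL : ∀ u u', MemW1p0 p (-T) T u u' → (∫ t in Ioo (-T) T, |u t| ^ p) = 1 →
      (∫ t in Ioo (-T) T, (a * ppart (u' t) + b * npart (u' t)) ^ p) = lamAB p a b (-T) T →
      (¬ ∀ t ∈ Ioo (-T) T, u t = 0) ∧ ∀ φ φ', MemW1p0 p (-T) T φ φ' →
        (∫ t in Ioo (-T) T,
            (a ^ p * ppart (u' t) ^ (p - 1) - b ^ p * npart (u' t) ^ (p - 1)) * φ' t)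
          = lamAB p a b (-T) T * ∫ t in Ioo (-T) T, |u t| ^ (p - 2) * u t * φ t := by
    refine fun u u' hu hN hE => ⟨fun h0 => ?_, fun φ φ' hφ =>
      euler_lagrange_of_attained hp hT' ha.le hb hu hN hE hφ⟩
    have : ∫ t in Ioo (-T) T, |u t| ^ p = 0 := by
      rw [setIntegral_congr_fun (g := fun _ => 0) measurableSet_Ioo fun t ht => by
        simp [h0 t ht, Real.zero_rpow hp0]]
      simp
    linarith
  have hpos : ∀ u u', MemW1p0 p (-T) T u u' → (¬ ∀ t ∈ Ioo (-T) T, u t = 0) →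
      (∀ φ φ', MemW1p0 p (-T) T φ φ' →
        (∫ t in Ioo (-T) T,
            (a ^ p * ppart (u' t) ^ (p - 1) - b ^ p * npart (u' t) ^ (p - 1)) * φ' t)
          = lamAB p a b (-T) T * ∫ t in Ioo (-T) T, |u t| ^ (p - 2) * u t * φ t) → 0 < b := by
    intro u u' hu hne h
    refine hb.lt_of_ne' ?_
    rintro rfl
    simp only [Real.zero_rpow hp0, zero_mul, sub_zero] at h
    exact hne fun t ht => eq_zero_of_degenerate_euler_lagrange hp hT.le (by positivity)
      (lamAB_nonneg ha.le le_rfl) hu h t (Ioo_subset_Icc_self ht)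
  refine ⟨⟨?_, exists_minimizer hp hT ha⟩, ⟨?_, fun hb' => ?_⟩⟩
  · rintro ⟨u, u', hu, hN, hE⟩
    obtain ⟨hne, h⟩ := hEL u u' hu hN hE
    exact hpos u u' hu hne h
  · rintro ⟨u, u', hu, hne, h⟩
    exact hpos u u' hu hne h
  · obtain ⟨u, u', hu, hN, hE⟩ := exists_minimizer hp hT ha hb'
    exact ⟨u, u', hu, hEL u u' hu hN hE⟩

end
end

section
/- Let p > 1 and T > 0, and let H: ℝ → ℝ be nonnegative, convex and positively 1-homogeneous, i.e. H = H_{a,b} with H_{a,b}(t) = a t^+ + b t^- for some a, b ≥ 0. Then λ_p^H(-T,T) := inf{∫_{-T}^T H(u'(t))^p dt : u ∈ W^{1,p}_0(-T,T), ∫_{-T}^T |u(t)|^p dt = 1} is strictly positive if and only if H is not identically zero. -/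
open MeasureTheory Filter Set
open scoped Topology RealInnerProductSpace

noncomputable section

theorem posHom_eq_ppart_add_npart {H : ℝ → ℝ}
    (hhom : ∀ s : ℝ, 0 < s → ∀ t : ℝ, H (s * t) = s * H t) (s : ℝ) :
    H s = H 1 * ppart s + H (-1) * npart s := by
  unfold ppart npart
  rcases lt_trichotomy s 0 with hs | rfl | hs
  · have h := hhom (-s) (by linarith) (-1)
    rw [max_eq_right hs.le, max_eq_left (by linarith)]
    simp only [mul_neg, mul_one, neg_neg] at h
    linarith
  · have h := hhom 2 (by norm_num) 0
    rw [mul_zero] at h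
    simp
    linarith
  · have h := hhom s hs 1
    rw [max_eq_left hs.le, max_eq_right (by linarith)]
    rw [mul_one] at h
    linarith

theorem posHom_continuous {H : ℝ → ℝ}
    (hhom : ∀ s : ℝ, 0 < s → ∀ t : ℝ, H (s * t) = s * H t) :
    Continuous H := by
  rw [funext (posHom_eq_ppart_add_npart hhom)]
  unfold ppart npart
  fun_prop

theorem posHom_le_mul_abs {H : ℝ → ℝ}
    (hhom : ∀ s : ℝ, 0 < s → ∀ t : ℝ, H (s * t) = s * H t)
    (h0 : ∀ t, 0 ≤ H t) (s : ℝ) : H s ≤ (H 1 + H (-1)) * |s| := by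
  rw [posHom_eq_ppart_add_npart hhom s, add_mul]
  gcongr
  · exact h0 1
  · exact max_le (le_abs_self s) (abs_nonneg s)
  · exact h0 (-1)
  · exact max_le (neg_le_abs s) (abs_nonneg s)

theorem posHom_exists_linear_le {H : ℝ → ℝ}
    (hhom : ∀ s : ℝ, 0 < s → ∀ t : ℝ, H (s * t) = s * H t)
    (h0 : ∀ t, 0 ≤ H t) (hH : H ≠ 0) :
    ∃ k : ℝ, k ≠ 0 ∧ ∀ s, k * s ≤ H s := by
  by_cases ha : H 1 = 0
  · refine ⟨-H (-1), fun hb => hH ?_, fun s => ?_⟩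
    · ext s
      rw [posHom_eq_ppart_add_npart hhom s, ha, neg_eq_zero.mp hb]
      simp
    · rw [posHom_eq_ppart_add_npart hhom s, ha, zero_mul, zero_add, neg_mul_comm]
      exact mul_le_mul_of_nonneg_left (le_max_left _ _) (h0 _)
  · refine ⟨H 1, ha, fun s => ?_⟩
    rw [posHom_eq_ppart_add_npart hhom s]
    have h1 : H 1 * s ≤ H 1 * ppart s := mul_le_mul_of_nonneg_left (le_max_left _ _) (h0 _)
    have h2 : 0 ≤ H (-1) * npart s := mul_nonneg (h0 _) (le_max_right _ _)
    linarith

theorem le_add_rpow_mul_rpow_s3 {p ε x : ℝ} (hp : 1 < p) (hε : 0 < ε) (hx : 0 ≤ x) :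
    x ≤ ε + ε ^ (1 - p) * x ^ p := by
  have hεp : 0 < ε ^ (1 - p) := Real.rpow_pos_of_pos hε _
  rcases le_total x ε with h | h
  · have := mul_nonneg hεp.le (Real.rpow_nonneg hx p)
    linarith
  · have hx0 : 0 < x := hε.trans_le h
    have h1 : x ^ (1 - p) ≤ ε ^ (1 - p) :=
      Real.rpow_le_rpow_of_nonpos hε h (by linarith)
    calc x = x ^ (1 - p) * x ^ p := by rw [← Real.rpow_add hx0]; simp
      _ ≤ ε ^ (1 - p) * x ^ p := by gcongr
      _ ≤ ε + ε ^ (1 - p) * x ^ p := by linarith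

/-- If `k s ≤ H s`, then the oscillation of a function in `W^{1,p}_0` is controlled in both
directions by the integral of `H` along the weak derivative. -/
theorem abs_mul_abs_le_integral_of_linear_le {p α β k : ℝ} (hαβ : α ≤ β) {H u u' : ℝ → ℝ}
    (h0 : ∀ t, 0 ≤ H t) (hk : ∀ s, k * s ≤ H s) (hu : MemW1p0 p α β u u')
    (hHu : IntervalIntegrable (fun t => H (u' t)) volume α β) {t : ℝ} (ht : t ∈ Set.Icc α β) :
    |k| * |u t| ≤ ∫ s in α..β, H (u' s) := by
  obtain ⟨⟨hi, hrep, -⟩, hα, hβ⟩ := hu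
  have hl : Set.uIcc α t ⊆ Set.uIcc α β := by
    rw [Set.uIcc_of_le ht.1, Set.uIcc_of_le hαβ]; exact Set.Icc_subset_Icc_right ht.2
  have hr : Set.uIcc t β ⊆ Set.uIcc α β := by
    rw [Set.uIcc_of_le ht.2, Set.uIcc_of_le hαβ]; exact Set.Icc_subset_Icc_left ht.1
  have hadd := intervalIntegral.integral_add_adjacent_intervals (hi.mono_set hl) (hi.mono_set hr)
  have hHadd :=
    intervalIntegral.integral_add_adjacent_intervals (hHu.mono_set hl) (hHu.mono_set hr)
  have hut := hrep t ht
  have huβ := hrep β ⟨hαβ, le_rfl⟩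
  have h1 : k * ∫ s in α..t, u' s ≤ ∫ s in α..t, H (u' s) := by
    rw [← intervalIntegral.integral_const_mul]
    exact intervalIntegral.integral_mono_on ht.1 ((hi.mono_set hl).const_mul k)
      (hHu.mono_set hl) fun s _ => hk _
  have h2 : k * ∫ s in t..β, u' s ≤ ∫ s in t..β, H (u' s) := by
    rw [← intervalIntegral.integral_const_mul]
    exact intervalIntegral.integral_mono_on ht.2 ((hi.mono_set hr).const_mul k)
      (hHu.mono_set hr) fun s _ => hk _
  have h3 : 0 ≤ ∫ s in α..t, H (u' s) :=
    intervalIntegral.integral_nonneg ht.1 fun s _ => h0 _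
  have h4 : 0 ≤ ∫ s in t..β, H (u' s) :=
    intervalIntegral.integral_nonneg ht.2 fun s _ => h0 _
  have e1 : ∫ s in α..t, u' s = u t := by linarith
  have e2 : ∫ s in t..β, u' s = -u t := by linarith
  rw [e1] at h1
  rw [e2] at h2
  rw [← abs_mul]
  exact abs_le.mpr ⟨by linarith, by linarith⟩

theorem rpow_neg_inv_le_of_integral_rpow_eq_one {p α β M : ℝ} (hp : 0 < p) (hαβ : α < β)
    {u : ℝ → ℝ} (hM : ∀ t ∈ Set.Ioo α β, |u t| ≤ M)
    (hu : ∫ t in Set.Ioo α β, |u t| ^ p = 1) : (β - α) ^ (-p⁻¹) ≤ M := by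
  have hL : 0 < β - α := sub_pos.mpr hαβ
  have hM0 : 0 ≤ M :=
    (abs_nonneg _).trans (hM ((α + β) / 2) ⟨by linarith, by linarith⟩)
  have h := norm_setIntegral_le_of_norm_le_const (μ := volume) (s := Set.Ioo α β)
    (f := fun t => |u t| ^ p) (C := M ^ p) (by simp) (fun t ht => by
      rw [Real.norm_of_nonneg (Real.rpow_nonneg (abs_nonneg _) _)]
      exact Real.rpow_le_rpow (abs_nonneg _) (hM t ht) hp.le)
  rw [hu, norm_one, Measure.real, Real.volume_Ioo, ENNReal.toReal_ofReal hL.le] at h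
  refine le_of_not_gt fun hlt => ?_
  have h2 : M ^ p < ((β - α) ^ (-p⁻¹)) ^ p := Real.rpow_lt_rpow hM0 hlt hp
  rw [← Real.rpow_mul hL.le, neg_mul, inv_mul_cancel₀ hp.ne', Real.rpow_neg_one] at h2
  have h3 := mul_lt_mul_of_pos_right h2 hL
  rw [inv_mul_cancel₀ hL.ne'] at h3
  linarith

theorem exists_memW1p0_integral_rpow_eq_one {p T : ℝ} (hp : 1 < p) (hT : 0 < T) :
    ∃ u u', MemW1p0 p (-T) T u u' ∧ ∫ t in Set.Ioo (-T) T, |u t| ^ p = 1 := by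
  have hp0 : 0 < p := by linarith
  set I : ℝ := ∫ t in Set.Ioo (-T) T, |T ^ 2 - t ^ 2| ^ p with hI
  have hcont : Continuous fun t : ℝ => |T ^ 2 - t ^ 2| ^ p :=
    Continuous.rpow_const (by fun_prop) fun _ => Or.inr hp0.le
  have hIpos : 0 < I := by
    rw [hI, ← integral_Ioc_eq_integral_Ioo, ← intervalIntegral.integral_of_le (by linarith)]
    refine intervalIntegral.intervalIntegral_pos_of_pos_on (hcont.intervalIntegrable _ _)
      (fun t ht => Real.rpow_pos_of_pos (abs_pos.mpr ?_) _) (by linarith)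
    nlinarith [ht.1, ht.2, mul_pos (sub_pos.mpr ht.2) (by linarith [ht.1] : 0 < T + t)]
  set c : ℝ := I ^ (-p⁻¹) with hc
  have hcpos : 0 < c := Real.rpow_pos_of_pos hIpos _
  have hderiv (t : ℝ) : HasDerivAt (fun t => c * (T ^ 2 - t ^ 2)) (c * (-(2 * t))) t := by
    simpa using (((hasDerivAt_id t).pow 2).const_sub (T ^ 2)).const_mul c
  have hcont' : Continuous fun t : ℝ => c * (-(2 * t)) := by fun_prop
  refine ⟨fun t => c * (T ^ 2 - t ^ 2), fun t => c * (-(2 * t)),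
    ⟨⟨hcont'.intervalIntegrable _ _, fun t _ => ?_, ?_⟩, by simp, by simp⟩, ?_⟩
  · rw [intervalIntegral.integral_eq_sub_of_hasDerivAt (fun s _ => hderiv s)
      (hcont'.intervalIntegrable _ _)]
    ring
  · have hcp : Continuous fun t : ℝ => |c * (-(2 * t))| ^ p :=
      Continuous.rpow_const (by fun_prop) fun _ => Or.inr hp0.le
    exact (hcp.integrableOn_Icc).mono_set Set.Ioo_subset_Icc_self
  · have h (t : ℝ) : |c * (T ^ 2 - t ^ 2)| ^ p = c ^ p * |T ^ 2 - t ^ 2| ^ p := by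
      rw [abs_mul, abs_of_pos hcpos, Real.mul_rpow hcpos.le (abs_nonneg _)]
    simp_rw [h]
    rw [integral_const_mul, ← hI, hc, ← Real.rpow_mul hIpos.le, neg_mul,
      inv_mul_cancel₀ hp0.ne', Real.rpow_neg_one, inv_mul_cancel₀ hIpos.ne']

theorem lamH1_pos_iff (p T : ℝ) (hp : 1 < p) (hT : 0 < T) (H : ℝ → ℝ)
    (h0 : ∀ t, 0 ≤ H t) (hconv : ConvexOn ℝ Set.univ H)
    (hhom : ∀ s : ℝ, 0 < s → ∀ t : ℝ, H (s * t) = s * H t) :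
    0 < lamH1 p H (-T) T ↔ H ≠ 0 := by
  have hp0 : 0 < p := by linarith
  have hTT : -T < T := by linarith
  obtain ⟨v, v', hv, hv1⟩ := exists_memW1p0_integral_rpow_eq_one hp hT
  constructor
  · rintro hpos rfl
    refine hpos.not_ge (csInf_le ⟨0, ?_⟩ ⟨v, v', hv, hv1, ?_⟩)
    · rintro E ⟨u, u', -, -, rfl⟩
      exact integral_nonneg fun t => Real.rpow_nonneg le_rfl _
    · simp [Real.zero_rpow hp0.ne']
  · intro hH
    obtain ⟨k, hk0, hk⟩ := posHom_exists_linear_le hhom h0 hH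
    set m : ℝ := |k| * (T - -T) ^ (-p⁻¹) with hm
    have hm0 : 0 < m := mul_pos (abs_pos.mpr hk0) (Real.rpow_pos_of_pos (by linarith) _)
    set ε : ℝ := m / (4 * T) with hε
    have hε0 : 0 < ε := by positivity
    have hεp : 0 < ε ^ (1 - p) := Real.rpow_pos_of_pos hε0 _
    refine lt_of_lt_of_le (b := m / 2 / ε ^ (1 - p)) (by positivity)
      (le_csInf ⟨_, v, v', hv, hv1, rfl⟩ ?_)
    rintro E ⟨u, u', hu, hu1, rfl⟩
    have hi : IntegrableOn u' (Set.Ioo (-T) T) :=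
      ((intervalIntegrable_iff_integrableOn_Ioo_of_le hTT.le).mp hu.1.1)
    have hmeas := (posHom_continuous hhom).comp_aestronglyMeasurable hi.aestronglyMeasurable
    have hHi : IntegrableOn (fun t => H (u' t)) (Set.Ioo (-T) T) := by
      refine Integrable.mono' (hi.abs.const_mul (H 1 + H (-1))) hmeas (.of_forall fun t => ?_)
      rw [Real.norm_of_nonneg (h0 _)]
      exact posHom_le_mul_abs hhom h0 _
    have hHp : IntegrableOn (fun t => H (u' t) ^ p) (Set.Ioo (-T) T) := by
      refine Integrable.mono' (hu.1.2.2.const_mul ((H 1 + H (-1)) ^ p))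
        ((Real.continuous_rpow_const hp0.le).comp_aestronglyMeasurable hmeas)
        (.of_forall fun t => ?_)
      rw [Real.norm_of_nonneg (Real.rpow_nonneg (h0 _) _),
        ← Real.mul_rpow (add_nonneg (h0 _) (h0 _)) (abs_nonneg _)]
      exact Real.rpow_le_rpow (h0 _) (posHom_le_mul_abs hhom h0 _) hp0.le
    have hmM : m ≤ ∫ t in Set.Ioo (-T) T, H (u' t) := by
      have h := rpow_neg_inv_le_of_integral_rpow_eq_one hp0 hTT
        (M := (∫ t in Set.Ioo (-T) T, H (u' t)) / |k|) (fun t ht => ?_) hu1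
      · rwa [le_div_iff₀' (abs_pos.mpr hk0)] at h
      · rw [le_div_iff₀' (abs_pos.mpr hk0), ← integral_Ioc_eq_integral_Ioo,
          ← intervalIntegral.integral_of_le hTT.le]
        exact abs_mul_abs_le_integral_of_linear_le hTT.le h0 hk hu
          ((intervalIntegrable_iff_integrableOn_Ioo_of_le hTT.le).mpr hHi)
          (Set.Ioo_subset_Icc_self ht)
    have hconst : IntegrableOn (fun _ : ℝ => ε) (Set.Ioo (-T) T) :=
      integrableOn_const (by simp)
    have hle : ∫ t in Set.Ioo (-T) T, H (u' t) ≤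
        ∫ t in Set.Ioo (-T) T, (ε + ε ^ (1 - p) * H (u' t) ^ p) :=
      integral_mono hHi (hconst.add (hHp.const_mul _)) fun t =>
        le_add_rpow_mul_rpow_s3 hp hε0 (h0 _)
    rw [integral_add hconst (hHp.const_mul _), integral_const_mul, setIntegral_const,
      Measure.real, Real.volume_Ioo, ENNReal.toReal_ofReal (by linarith), smul_eq_mul] at hle
    have hεm : (T - -T) * ε = m / 2 := by
      rw [hε]
      field_simp
      ring
    rw [div_le_iff₀' hεp]
    linarith

end
end
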